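/- arXiv:2411.09806 — 2 statements merged into one kernel-verified Lean document; each statement's English description precedes it below -/
import Mathlib

section
/- Let t ≥ 2 be an even integer, let G be a 3-connected 2t-regular finite simple graph, and let 𝒪 be a set of pairwise edge-disjoint cycles of G, each of length at least 3. Then there exists an orientation of G such that (i) every vertex of G has even indegree, and (ii) no cycle of 𝒪 is an oriented cycle with respect to this orientation. -/
open SimpleGraph

namespace PaperFormalization

variable {V : Type*}

/-- The degree of a vertex in a subgraph. -/
noncomputable def sdeg {G : SimpleGraph V} (H : G.Subgraph) (v : V) : ℕ :=
  (H.neighborSet v).ncard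

/-- `H` is a `t`-factor of `G`: a spanning subgraph in which every vertex has degree `t`. -/
def IsTFactor {G : SimpleGraph V} (H : G.Subgraph) (t : ℕ) : Prop :=
  H.IsSpanning ∧ ∀ v : V, sdeg H v = t

/-- A cycle of `G`: a connected 2-regular subgraph. -/
def IsCycleSG {G : SimpleGraph V} (C : G.Subgraph) : Prop :=
  C.Connected ∧ ∀ v ∈ C.verts, sdeg C v = 2

/-- An odd cycle: a cycle with an odd number of edges. -/
def IsOddCycleSG {G : SimpleGraph V} (C : G.Subgraph) : Prop :=
  IsCycleSG C ∧ Odd C.edgeSet.ncard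

/-- A family of subgraphs is pairwise edge-disjoint. -/
def PairwiseEdgeDisjoint {G : SimpleGraph V} (𝒪 : Set G.Subgraph) : Prop :=
  𝒪.Pairwise fun O₁ O₂ => Disjoint O₁.edgeSet O₂.edgeSet

/-- A family of subgraphs is pairwise vertex-disjoint. -/
def PairwiseVertexDisjoint {G : SimpleGraph V} (𝒪 : Set G.Subgraph) : Prop :=
  𝒪.Pairwise fun O₁ O₂ => Disjoint O₁.verts O₂.verts

/-- `G` is `r`-regular. -/
def IsRegular (G : SimpleGraph V) (r : ℕ) : Prop :=
  ∀ v : V, (G.neighborSet v).ncard = r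

/-- `G` is 2-connected: connected, at least 3 vertices, and no cut vertex. -/
def TwoConnected [Fintype V] (G : SimpleGraph V) : Prop :=
  G.Connected ∧ 3 ≤ Fintype.card V ∧ ∀ v : V, (G.induce {u | u ≠ v}).Connected

/-- `G` is `r`-connected: more than `r` vertices and deleting fewer than `r`
vertices leaves it connected. -/
def KConnected [Fintype V] (r : ℕ) (G : SimpleGraph V) : Prop :=
  r < Fintype.card V ∧ ∀ S : Set V, S.ncard < r → (G.induce Sᶜ).Connected

/-- A set of edges is a matching: pairwise non-adjacent edges. -/
def IsMatchingSet (M : Set (Sym2 V)) : Prop :=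
  M.Pairwise fun e f => ∀ v : V, v ∈ e → v ∉ f

/-- An orientation of `G`: each edge receives exactly one direction. -/
structure Orient {W : Type*} (G : SimpleGraph W) where
  dir : W → W → Prop
  adj_iff : ∀ u v : W, G.Adj u v ↔ (dir u v ∨ dir v u)
  asymm : ∀ u v : W, dir u v → ¬ dir v u

/-- The indegree of a vertex with respect to an orientation. -/
noncomputable def indeg {W : Type*} {G : SimpleGraph W} (D : Orient G) (v : W) : ℕ :=
  {u : W | D.dir u v}.ncard

/-- A cycle `C` is an oriented cycle w.r.t. `D` if at every vertex of `C` exactly one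
of the two edges of `C` incident with it is directed towards it. -/
def IsOrientedCycle {W : Type*} {G : SimpleGraph W} (D : Orient G) (C : G.Subgraph) : Prop :=
  ∀ v ∈ C.verts, ∃! u : W, C.Adj u v ∧ D.dir u v

lemma even_degree_exists_isCycle [Finite V] (R : SimpleGraph V)
    (heven : ∀ v, Even (R.neighborSet v).ncard) {u v : V} (huv : R.Adj u v) :
    ∃ (w : V) (c : R.Walk w w), c.IsCycle := by
  classical
  cases nonempty_fintype V
  by_contra! hno
  have hac : R.IsAcyclic := fun w c hc => hno w c hc
  have hbr := isAcyclic_iff_forall_adj_isBridge.1 hac huv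
  have hnr : ¬ (R.deleteEdges {s(u, v)}).Reachable u v := hbr
  set R' := R.deleteEdges {s(u, v)} with hR'
  let H : SimpleGraph V :=
    { Adj := fun x y => R'.Adj x y ∧ R'.Reachable u x
      symm := ⟨fun x y h => ⟨h.1.symm, h.2.trans h.1.reachable⟩⟩
      loopless := ⟨fun x h => R'.loopless.1 x h.1⟩ }
  have hsetu : H.neighborSet u = R.neighborSet u \ {v} := by
    ext y
    simp only [H, hR', mem_neighborSet, deleteEdges_adj, Set.mem_singleton_iff, Set.mem_sdiff,
      Reachable.refl, and_true]
    have := huv.ne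
    aesop
  have hdeg : ∀ x, H.degree x = (H.neighborSet x).ncard := fun x => by
    rw [Set.ncard_eq_toFinset_card', ← card_neighborFinset_eq_degree]; rfl
  have hu : Odd (H.degree u) := by
    rw [hdeg, hsetu, Set.ncard_sdiff_singleton_of_mem (by simpa using huv)]
    have h1 : 0 < (R.neighborSet u).ncard := (Set.ncard_pos).2 ⟨v, huv⟩
    have h2 := heven u
    grind
  obtain ⟨w, hwu, hw⟩ := H.exists_ne_odd_degree_of_exists_odd_degree u hu
  rw [hdeg] at hw
  have hreach : R'.Reachable u w := by
    by_contra hcon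
    have : H.neighborSet w = ∅ := by
      ext y
      simp [H, hcon]
    simp [this] at hw
  have hwv : w ≠ v := fun h => hnr (h ▸ hreach)
  have : H.neighborSet w = R.neighborSet w := by
    ext y
    simp only [H, hR', mem_neighborSet, deleteEdges_adj, Set.mem_singleton_iff]
    have := hreach
    simp only [hR'] at this
    aesop
  rw [this] at hw
  exact (Nat.not_even_iff_odd.2 hw) (heven w)

lemma subgraph_edge_disjoint_iff {G : SimpleGraph V} {A B : G.Subgraph} :
    Disjoint A.edgeSet B.edgeSet ↔ ∀ u v, A.Adj u v → ¬ B.Adj u v := by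
  rw [Set.disjoint_left]
  constructor
  · intro h u v hA hB
    exact h (a := s(u, v)) hA hB
  · intro h e
    induction e with
    | h u v => exact h u v

lemma ncard_exists_mem_eq_sum {α ι : Type*} [Finite α] (s : Finset ι) (P : ι → α → Prop)
    (hP : ∀ i ∈ s, ∀ j ∈ s, i ≠ j → ∀ a, P i a → ¬ P j a) :
    {a | ∃ i ∈ s, P i a}.ncard = ∑ i ∈ s, {a | P i a}.ncard := by
  classical
  cases nonempty_fintype α
  have h : {a | ∃ i ∈ s, P i a} = ↑(s.biUnion fun i => Finset.univ.filter (P i)) := by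
    ext a
    simp
  rw [h, Set.ncard_coe_finset, Finset.card_biUnion]
  · refine Finset.sum_congr rfl fun i _ => ?_
    rw [← Set.ncard_coe_finset]
    simp
  · intro i hi j hj hij
    rw [Function.onFun, Finset.disjoint_left]
    intro a ha hb
    simp only [Finset.mem_filter, Finset.mem_univ, true_and] at ha hb
    exact hP i hi j hj hij a ha hb

/-- In an edge-disjoint family of cycles, the neighbours of `v` covered by the family number
twice the cycles through `v`. -/
lemma ncard_covered_neighbors [Finite V] {G : SimpleGraph V} {𝒪 : Set G.Subgraph}
    (hcyc : ∀ O ∈ 𝒪, IsCycleSG O) (hdisj : PairwiseEdgeDisjoint 𝒪) (v : V) :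
    {u | ∃ O ∈ 𝒪, O.Adj v u}.ncard = 2 * {O | O ∈ 𝒪 ∧ v ∈ O.verts}.ncard := by
  classical
  have hfin : {O | O ∈ 𝒪 ∧ v ∈ O.verts}.Finite := Set.toFinite _
  have h1 : {u | ∃ O ∈ 𝒪, O.Adj v u} = {u | ∃ O ∈ hfin.toFinset, O.Adj v u} := by
    ext u
    simp only [Set.mem_ofPred_eq, Set.Finite.mem_toFinset]
    exact ⟨fun ⟨O, h, h'⟩ => ⟨O, ⟨h, h'.fst_mem⟩, h'⟩, fun ⟨O, h, h'⟩ => ⟨O, h.1, h'⟩⟩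
  rw [h1, ncard_exists_mem_eq_sum, Finset.sum_congr rfl (g := fun _ => 2), Finset.sum_const,
    Set.ncard_eq_toFinset_card _ hfin, smul_eq_mul, mul_comm]
  · intro O hO
    simp only [Set.Finite.mem_toFinset, Set.mem_ofPred_eq] at hO
    exact (hcyc O hO.1).2 v hO.2
  · intro O hO O' hO' hne
    simp only [Set.Finite.mem_toFinset, Set.mem_ofPred_eq] at hO hO'
    exact subgraph_edge_disjoint_iff.1 (hdisj hO.1 hO'.1 hne) v

lemma exists_cycle_decomposition [Finite V] {G : SimpleGraph V} (t : ℕ)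
    (hreg : IsRegular G (2 * t)) (𝒪 : Set G.Subgraph) (hcyc : ∀ O ∈ 𝒪, IsCycleSG O)
    (hdisj : PairwiseEdgeDisjoint 𝒪) :
    ∃ 𝒟 : Set G.Subgraph, 𝒪 ⊆ 𝒟 ∧ (∀ O ∈ 𝒟, IsCycleSG O) ∧ PairwiseEdgeDisjoint 𝒟 ∧
      ∀ u v, G.Adj u v → ∃ O ∈ 𝒟, O.Adj u v := by
  obtain ⟨𝒟, hle, hmax⟩ := (Set.toFinite {𝒟 : Set G.Subgraph | (∀ O ∈ 𝒟, IsCycleSG O) ∧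
    PairwiseEdgeDisjoint 𝒟}).exists_le_maximal (a := 𝒪) ⟨hcyc, hdisj⟩
  obtain ⟨hc, hd⟩ := hmax.prop
  refine ⟨𝒟, hle, hc, hd, ?_⟩
  by_contra! ⟨u, v, huv, hun⟩
  let R : SimpleGraph V :=
    { Adj := fun x y => G.Adj x y ∧ ∀ O ∈ 𝒟, ¬ O.Adj x y
      symm := ⟨fun x y h => ⟨h.1.symm, fun O hO hA => h.2 O hO hA.symm⟩⟩
      loopless := ⟨fun x h => G.loopless.1 x h.1⟩ }
  have hRG : R ≤ G := fun x y h => h.1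
  have heven : ∀ x, Even (R.neighborSet x).ncard := by
    intro x
    have h1 := ncard_covered_neighbors hc hd x
    have h2 := hreg x
    have hsub : {u | ∃ O ∈ 𝒟, O.Adj x u} ⊆ G.neighborSet x := by
      rintro y ⟨O, -, h⟩
      exact h.adj_sub
    have h3 : R.neighborSet x = G.neighborSet x \ {u | ∃ O ∈ 𝒟, O.Adj x u} := by
      ext y
      simp [R]
    rw [h3, Set.ncard_sdiff hsub, h1, h2, ← Nat.mul_sub]
    exact even_two_mul _
  obtain ⟨w, c, hcc⟩ := even_degree_exists_isCycle R heven (u := u) (v := v) ⟨huv, hun⟩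
  have hadjR : ∀ x y, (c.mapLe hRG).toSubgraph.Adj x y → R.Adj x y := by
    intro x y h
    have h' : s(x, y) ∈ (c.mapLe hRG).edges := (Walk.mem_edges_toSubgraph _).1 h
    rw [Walk.edges_mapLe_eq_edges] at h'
    exact c.adj_of_mem_edges h'
  have hC : IsCycleSG (c.mapLe hRG).toSubgraph := by
    refine ⟨Walk.toSubgraph_connected _, fun x hx => ?_⟩
    exact (hcc.mapLe hRG).ncard_neighborSet_toSubgraph_eq_two (by simpa using hx)
  have hmem : (c.mapLe hRG).toSubgraph ∈ 𝒟 := by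
    refine hmax.mem_of_prop_insert ⟨?_, ?_⟩
    · rintro O (rfl | hO)
      exacts [hC, hc O hO]
    · refine Set.Pairwise.insert hd fun O hO _ => ?_
      have : Disjoint O.edgeSet (c.mapLe hRG).toSubgraph.edgeSet :=
        subgraph_edge_disjoint_iff.2 fun x y h1 h2 => (hadjR x y h2).2 O hO h1
      exact ⟨this.symm, this⟩
  obtain ⟨y, hy⟩ : ∃ y, (c.mapLe hRG).toSubgraph.Adj w y := by
    have := hC.2 w (Walk.start_mem_verts_toSubgraph _)
    have h2 : ((c.mapLe hRG).toSubgraph.neighborSet w).Nonempty := by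
      rw [← Set.ncard_pos]
      unfold sdeg at this
      omega
    exact h2
  exact (hadjR w y hy).2 _ hmem hy

lemma exists_orient (H : SimpleGraph V) : Nonempty (Orient H) := by
  classical
  let _ : LinearOrder V := IsWellOrder.linearOrder WellOrderingRel
  exact ⟨{
    dir := fun u v => H.Adj u v ∧ u < v
    adj_iff := fun u v => by
      constructor
      · intro h
        rcases lt_or_gt_of_ne h.ne with h' | h'
        exacts [Or.inl ⟨h, h'⟩, Or.inr ⟨h.symm, h'⟩]
      · rintro (h | h)
        exacts [h.1, h.1.symm]
    asymm := fun u v h h' => lt_asymm h.2 h'.2 }⟩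

lemma Orient.flip_dir [Finite V] [DecidableEq V] {H : SimpleGraph V} (D : Orient H) {u w : V}
    (huw : D.dir u w) :
    ∃ D' : Orient H, ∀ x, (indeg D' x : ZMod 2) =
      indeg D x + ((if x = u then 1 else 0) + if x = w then 1 else 0) := by
  have hwu : ¬ D.dir w u := D.asymm u w huw
  have hne : u ≠ w := by
    rintro rfl
    exact hwu huw
  have hadj : H.Adj u w := (D.adj_iff u w).2 (Or.inl huw)
  let D' : Orient H :=
    { dir := fun x y => (D.dir x y ∧ ¬ (x = u ∧ y = w)) ∨ (x = w ∧ y = u)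
      adj_iff := fun x y => by
        rw [D.adj_iff]
        grind
      asymm := fun x y h => by
        have := D.asymm x y
        grind }
  refine ⟨D', fun x => ?_⟩
  by_cases hxu : x = u
  · subst hxu
    have hset : {y | D'.dir y x} = insert w {y | D.dir y x} := by
      ext y
      simp only [D', Set.mem_ofPred_eq, Set.mem_insert_iff]
      grind
    have : indeg D' x = indeg D x + 1 := by
      unfold indeg
      rw [hset, Set.ncard_insert_of_notMem (by simpa using hwu)]
    simp [this, hne]
  by_cases hxw : x = w
  · subst hxw
    have hset : insert u {y | D'.dir y x} = {y | D.dir y x} := by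
      ext y
      simp only [D', Set.mem_ofPred_eq, Set.mem_insert_iff]
      grind
    have : indeg D x = indeg D' x + 1 := by
      unfold indeg
      rw [← hset, Set.ncard_insert_of_notMem]
      simp [D', hne]
    simp only [this, Nat.cast_add, Nat.cast_one, if_neg hxu, if_true, zero_add]
    rw [add_assoc, CharTwo.add_self_eq_zero, add_zero]
  · have : indeg D' x = indeg D x := by
      unfold indeg
      congr 1
      ext y
      simp only [D', Set.mem_ofPred_eq]
      grind
    simp [this, hxu, hxw]

lemma Orient.flip_reachable [Finite V] [DecidableEq V] {H : SimpleGraph V} (D : Orient H)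
    {u w : V} (huw : H.Reachable u w) :
    ∃ D' : Orient H, ∀ x, (indeg D' x : ZMod 2) =
      indeg D x + ((if x = u then 1 else 0) + if x = w then 1 else 0) := by
  obtain ⟨p⟩ := huw
  induction p with
  | nil => exact ⟨D, fun x => by rw [CharTwo.add_self_eq_zero, add_zero]⟩
  | @cons a b c hab p ih =>
    obtain ⟨D₁, h₁⟩ := ih
    have : ∃ D' : Orient H, ∀ x, (indeg D' x : ZMod 2) =
        indeg D₁ x + ((if x = a then 1 else 0) + if x = b then 1 else 0) := by
      rcases (D₁.adj_iff a b).1 hab with h | h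
      · exact D₁.flip_dir h
      · obtain ⟨D', hD'⟩ := D₁.flip_dir h
        exact ⟨D', fun x => by rw [hD' x, add_comm (ite _ _ _)]⟩
    obtain ⟨D', hD'⟩ := this
    refine ⟨D', fun x => ?_⟩
    rw [hD', h₁]
    have := CharTwo.add_self_eq_zero (if x = b then (1 : ZMod 2) else 0)
    linear_combination this

/-- Indegree parities on a set of mutually reachable vertices can be prescribed up to their sum. -/
lemma Orient.exists_indeg_eq [Fintype V] {H : SimpleGraph V} (A : Finset V)
    (hA : ∀ u ∈ A, ∀ w ∈ A, H.Reachable u w) (p : V → ZMod 2) (D : Orient H)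
    (hsum : ∑ v ∈ A, (indeg D v : ZMod 2) = ∑ v ∈ A, p v) :
    ∃ D' : Orient H, ∀ v ∈ A, (indeg D' v : ZMod 2) = p v := by
  classical
  induction hn : (A.filter fun v => (indeg D v : ZMod 2) ≠ p v).card using Nat.strong_induction_on
    generalizing D with
  | _ n ih =>
  by_cases hall : ∀ v ∈ A, (indeg D v : ZMod 2) = p v
  · exact ⟨D, hall⟩
  push Not at hall
  obtain ⟨x, hxA, hx⟩ := hall
  have hy : ∃ y ∈ A, y ≠ x ∧ (indeg D y : ZMod 2) ≠ p y := by
    by_contra! hcon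
    rw [← Finset.add_sum_erase A _ hxA, ← Finset.add_sum_erase A p hxA,
      Finset.sum_congr rfl (fun y hy => hcon y (Finset.mem_of_mem_erase hy)
        (Finset.ne_of_mem_erase hy))] at hsum
    exact hx (add_right_cancel hsum)
  obtain ⟨y, hyA, hyx, hy⟩ := hy
  obtain ⟨D', hD'⟩ := D.flip_reachable (hA x hxA y hyA)
  have key : ∀ a b : ZMod 2, a ≠ b → a + 1 = b := by decide
  refine ih _ ?_ D' ?_ rfl
  · rw [← hn]
    refine Finset.card_lt_card ⟨?_, fun hsub => ?_⟩
    · intro z hz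
      simp only [Finset.mem_filter, hD'] at hz ⊢
      refine ⟨hz.1, fun h => hz.2 ?_⟩
      have hzx : z ≠ x := fun h' => hx (h' ▸ h)
      have hzy : z ≠ y := fun h' => hy (h' ▸ h)
      simp [hzx, hzy, h]
    · have := hsub (Finset.mem_filter.2 ⟨hxA, hx⟩)
      simp only [Finset.mem_filter, hD'] at this
      exact this.2 (by simpa [hyx.symm] using key _ _ hx)
  · rw [← hsum]
    simp_rw [hD', Finset.sum_add_distrib]
    rw [Finset.sum_ite_eq' , Finset.sum_ite_eq', if_pos hxA, if_pos hyA,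
      CharTwo.add_self_eq_zero, add_zero]

lemma sum_indeg_eq [Fintype V] {G : SimpleGraph V} {O : G.Subgraph} (hO : IsCycleSG O)
    (D : Orient O.spanningCoe) (A : Finset V) (hA : ∀ v, v ∈ A ↔ v ∈ O.verts) :
    ∑ v ∈ A, indeg D v = A.card := by
  classical
  have hin : ∀ v, indeg D v = ∑ u ∈ A, if D.dir u v then 1 else 0 := by
    intro v
    rw [Finset.sum_boole, Nat.cast_id, ← Set.ncard_coe_finset]
    unfold indeg
    congr 1
    ext u
    simp only [Set.mem_ofPred_eq, Finset.coe_filter, hA]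
    refine ⟨fun h => ⟨?_, h⟩, fun h => h.2⟩
    exact ((D.adj_iff u v).2 (Or.inl h) : O.Adj u v).fst_mem
  have htwo : ∀ v ∈ A, (∑ u ∈ A, if D.dir u v then 1 else 0) +
      (∑ u ∈ A, if D.dir v u then 1 else 0) = 2 := by
    intro v hv
    rw [← hO.2 v ((hA v).1 hv), ← Finset.sum_add_distrib]
    unfold sdeg
    have : O.neighborSet v = ↑(A.filter fun u => O.Adj v u) := by
      ext u
      simp only [Subgraph.mem_neighborSet, Finset.coe_filter, Set.mem_ofPred_eq, hA]
      exact ⟨fun h => ⟨h.snd_mem, h⟩, fun h => h.2⟩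
    rw [this, Set.ncard_coe_finset, Finset.card_filter]
    refine Finset.sum_congr rfl fun u _ => ?_
    have h1 : O.Adj v u ↔ D.dir v u ∨ D.dir u v := D.adj_iff v u
    have h2 := D.asymm v u
    by_cases ha : D.dir v u <;> by_cases hb : D.dir u v <;> simp_all
  have h := Finset.sum_congr rfl htwo
  rw [Finset.sum_add_distrib, Finset.sum_comm (s := A) (t := A) (f := fun v u =>
    if D.dir v u then 1 else 0), Finset.sum_const, smul_eq_mul] at h
  rw [Finset.sum_congr rfl fun v _ => hin v]
  omega

/-- A cycle has an orientation with the prescribed indegree parities, provided an even number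
of vertices is to have even indegree. -/
lemma IsCycleSG.exists_orient_indeg [Fintype V] {G : SimpleGraph V} {O : G.Subgraph}
    (hO : IsCycleSG O) (p : V → Prop) (hp : Even {v | v ∈ O.verts ∧ ¬ p v}.ncard) :
    ∃ D : Orient O.spanningCoe, ∀ v ∈ O.verts, (Even (indeg D v) ↔ ¬ p v) := by
  classical
  obtain ⟨D₀⟩ := exists_orient O.spanningCoe
  set A : Finset V := Finset.univ.filter (· ∈ O.verts) with hAdef
  have hA : ∀ v, v ∈ A ↔ v ∈ O.verts := by simp [A]
  have hreach : ∀ u ∈ A, ∀ w ∈ A, O.spanningCoe.Reachable u w := by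
    intro u hu w hw
    have := hO.1.coe.preconnected ⟨u, (hA u).1 hu⟩ ⟨w, (hA w).1 hw⟩
    exact this.map (⟨Subtype.val, fun h => h⟩ : O.coe →g O.spanningCoe)
  obtain ⟨D, hD⟩ := D₀.exists_indeg_eq A hreach (fun v => if p v then 1 else 0) (by
    rw [← Nat.cast_sum, sum_indeg_eq hO D₀ A hA, Finset.sum_boole,
      ← Finset.card_filter_add_card_filter_not p (s := A), Nat.cast_add]
    have h2 : ((A.filter fun v => ¬ p v).card : ZMod 2) = 0 := by
      rw [ZMod.natCast_eq_zero_iff_even, ← Set.ncard_coe_finset]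
      convert hp using 2
      ext v
      simp [A]
    rw [h2, add_zero])
  refine ⟨D, fun v hv => ?_⟩
  rw [← ZMod.natCast_eq_zero_iff_even, hD v ((hA v).2 hv)]
  by_cases h : p v <;> simp [h]

/-- Tutte's theorem, with components given by a colouring of the vertices outside `U` that is
constant along edges, and the matching as a fixed-point-free involution. -/
lemma exists_matching_involution {N : Type*} [Finite N] (M : SimpleGraph N)
    (h : ∀ (U : Set N) (cmp : N → Option ((⊤ : M.Subgraph).deleteVerts U).coe.ConnectedComponent),
      (∀ n, cmp n = none ↔ n ∈ U) →
      (∀ n m, n ∉ U → m ∉ U → M.Adj n m → cmp n = cmp m) →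
      {k | Odd {n | cmp n = some k}.ncard}.ncard ≤ U.ncard) :
    ∃ f : N → N, (∀ n, M.Adj n (f n)) ∧ ∀ n, f (f n) = n := by
  classical
  obtain ⟨P, hP⟩ : ∃ P : M.Subgraph, P.IsPerfectMatching := by
    rw [tutte]
    intro U hU
    have hmem : ∀ n, n ∈ ((⊤ : M.Subgraph).deleteVerts U).verts ↔ n ∉ U := by simp
    refine absurd hU (not_lt.2 ?_)
    refine le_trans (le_of_eq ?_) (h U (fun n => if hn : n ∉ U then
      some (connectedComponentMk _ ⟨n, (hmem n).2 hn⟩) else none) ?_ ?_)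
    · congr 1
      ext k
      simp only [Set.mem_ofPred_eq]
      rw [← Set.ncard_image_of_injective k.supp Subtype.val_injective]
      congr! 2
      ext n
      simp only [Set.mem_image, ConnectedComponent.mem_supp_iff, Subtype.exists, Set.mem_ofPred_eq]
      constructor
      · rintro ⟨m, hm, hk, rfl⟩
        rw [dif_pos ((hmem m).1 hm), hk]
      · intro hk
        by_cases hn : n ∉ U
        · rw [dif_pos hn] at hk
          exact ⟨n, (hmem n).2 hn, Option.some.inj hk, rfl⟩
        · rw [dif_neg hn] at hk
          cases hk
    · intro n
      by_cases hn : n ∈ U <;> simp [hn]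
    · intro n m hn hm hadj
      rw [dif_pos hn, dif_pos hm]
      congr 1
      refine ConnectedComponent.sound (Adj.reachable ?_)
      simp [hn, hm, hadj]
  rw [Subgraph.isPerfectMatching_iff] at hP
  choose f hf hu using hP
  exact ⟨f, fun n => (hf n).adj_sub, fun n => (hu _ _ (hf n).symm).symm⟩

section Blocks

variable {B : Type*} (I : V → B → Prop)

/-- The incidences of a block system, together with two extra nodes for each block. -/
abbrev BlockNode : Type _ := {i : V × B // I i.1 i.2} ⊕ (B × Bool)

/-- Incidences are adjacent if they share their point or their block; an extra node is adjacent
to the incidences of its block. -/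
def blockGraph : SimpleGraph (BlockNode I) where
  Adj
    | .inl i, .inl j => i ≠ j ∧ (i.1.1 = j.1.1 ∨ i.1.2 = j.1.2)
    | .inl i, .inr c => i.1.2 = c.1
    | .inr c, .inl i => i.1.2 = c.1
    | .inr _, .inr _ => False
  symm := ⟨by
    rintro (i | c) (j | d) h
    · exact ⟨h.1.symm, h.2.imp Eq.symm Eq.symm⟩
    all_goals exact h⟩
  loopless := ⟨by
    rintro (i | c) h
    · exact h.1 rfl
    · exact h⟩

lemma even_ncard_of_involution {α : Type*} [Finite α] (s : Set α) (f : α → α)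
    (hs : ∀ a ∈ s, f a ∈ s) (hne : ∀ a ∈ s, f a ≠ a) (hf : ∀ a ∈ s, f (f a) = a) :
    Even s.ncard := by
  have hfin := s.toFinite
  rw [Set.ncard_eq_toFinset_card s hfin, ← ZMod.natCast_eq_zero_iff_even, Finset.cast_card]
  simp_rw [← hfin.mem_toFinset] at hs hne hf
  exact Finset.sum_involution (fun a _ => f a) (fun a _ => CharTwo.add_self_eq_zero _)
    (fun a ha _ => hne a ha) (fun a ha => hs a ha) (fun a ha => hf a ha)

/-- The nodes at a set of points and a set of blocks are even in number if every point lies in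
an even number of blocks. -/
lemma even_card_blockNodes [Fintype V] [Fintype B] (hI : ∀ v, Even {b | I v b}.ncard)
    (Kv : V → Prop) (Kb : B → Prop) :
    Even {n : BlockNode I | (∃ i, n = .inl i ∧ Kv i.1.1) ∨ ∃ c, n = .inr c ∧ Kb c.1}.ncard := by
  classical
  have h1 : ∀ v, Even (∑ b, if I v b then if Kv v then 1 else 0 else 0) := by
    intro v
    by_cases hv : Kv v
    · simp only [hv, if_true, Finset.sum_boole]
      have := hI v
      rw [Set.ncard_eq_toFinset_card'] at this
      simpa using this
    · simp [hv]
  rw [Set.ncard_eq_toFinset_card', Set.toFinset_ofPred, Finset.card_filter, Fintype.sum_sum_type]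
  refine Even.add ?_ ?_
  · have : (∑ i : {i : V × B // I i.1 i.2}, if Kv i.1.1 then 1 else 0) =
        ∑ v, ∑ b, if I v b then if Kv v then 1 else 0 else 0 := by
      rw [← Fintype.sum_prod_type' (f := fun v b => if I v b then if Kv v then 1 else 0 else 0)]
      exact ((Finset.sum_filter _ _).symm.trans <| Finset.sum_subtype (p := fun i : V × B => I i.1 i.2)
        (Finset.univ.filter fun i : V × B => I i.1 i.2) (by simp) (fun i : V × B => if Kv i.1 then 1 else 0)).symm
    simp only [Sum.inl.injEq, reduceCtorEq, false_and, exists_false, or_false, exists_eq_left']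
    rw [this]
    exact Finset.even_sum _ fun v _ => h1 v
  · simp only [Sum.inr.injEq, reduceCtorEq, false_and, exists_false, false_or, exists_eq_left']
    rw [Fintype.sum_prod_type]
    refine Finset.even_sum _ fun b _ => ?_
    rw [Fintype.sum_bool]
    exact ⟨_, rfl⟩

section Tokens

variable {I} {K : Type*} (U : Set (BlockNode I)) (cmp : BlockNode I → Option K)

open Classical in
/-- The component of the remaining incidences at the point `v`, if there are any. -/
noncomputable def pointComp (v : V) : Option K :=
  if h : ∃ i : {i : V × B // I i.1 i.2}, i.1.1 = v ∧ .inl i ∉ U then cmp (.inl h.choose) else none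

open Classical in
/-- The component of the remaining incidences of a block, or, if there are none, of one of its
extra nodes. -/
noncomputable def blockComp (c : B × Bool) : Option K :=
  if h : ∃ i : {i : V × B // I i.1 i.2}, i.1.2 = c.1 ∧ .inl i ∉ U then cmp (.inl h.choose)
  else cmp (.inr c)

/-- The components receiving the three tokens of a removed node. -/
noncomputable def token : BlockNode I × Fin 3 → Option K
  | (.inl i, k) =>
    if k = 0 then pointComp U cmp i.1.1 else blockComp U cmp (i.1.2, decide (k = 1))
  | (.inr c, _) => blockComp U cmp c

variable {U cmp}

lemma pointComp_eq (hcmp : ∀ n m, n ∉ U → m ∉ U → (blockGraph I).Adj n m → cmp n = cmp m)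
    {i : {i : V × B // I i.1 i.2}} (hi : .inl i ∉ U) : pointComp U cmp i.1.1 = cmp (.inl i) := by
  have h : ∃ j : {i : V × B // I i.1 i.2}, j.1.1 = i.1.1 ∧ .inl j ∉ U := ⟨i, rfl, hi⟩
  rw [pointComp, dif_pos h]
  by_cases hij : h.choose = i
  · rw [hij]
  · exact hcmp _ _ h.choose_spec.2 hi ⟨hij, Or.inl h.choose_spec.1⟩

lemma blockComp_eq (hcmp : ∀ n m, n ∉ U → m ∉ U → (blockGraph I).Adj n m → cmp n = cmp m)
    {i : {i : V × B // I i.1 i.2}} (hi : .inl i ∉ U) (e : Bool) :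
    blockComp U cmp (i.1.2, e) = cmp (.inl i) := by
  have h : ∃ j : {i : V × B // I i.1 i.2}, j.1.2 = i.1.2 ∧ .inl j ∉ U := ⟨i, rfl, hi⟩
  rw [blockComp, dif_pos h]
  by_cases hij : h.choose = i
  · rw [hij]
  · exact hcmp _ _ h.choose_spec.2 hi ⟨hij, Or.inr h.choose_spec.1⟩

/-- Every odd component receives at least three tokens. -/
lemma three_le_card_token [Fintype V] [Fintype B] (hI : ∀ v, Even {b | I v b}.ncard)
    (hB : ∀ b, 3 ≤ {v | I v b}.ncard)
    (hbridge : ∀ (A : Set V) (v₀ : V) (b₀ : B), v₀ ∈ A → I v₀ b₀ →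
      (∀ v ∈ A, I v b₀ → v = v₀) → ∃ v ∈ A, ∃ b ≠ b₀, I v b ∧ ∃ w, I w b ∧ w ∉ A)
    (hU : ∀ n, cmp n = none ↔ n ∈ U)
    (hcmp : ∀ n m, n ∉ U → m ∉ U → (blockGraph I).Adj n m → cmp n = cmp m) (k : K)
    (hk : Odd {n | cmp n = some k}.ncard) :
    3 ≤ {x : BlockNode I × Fin 3 | x.1 ∈ U ∧ token U cmp x = some k}.ncard := by
  classical
  by_contra! hlt
  set F := {x : BlockNode I × Fin 3 | x.1 ∈ U ∧ token U cmp x = some k} with hF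
  have hthree : ∀ x y z, x ∈ F → y ∈ F → z ∈ F → x ≠ y → x ≠ z → y ≠ z → False := by
    intro x y z hx hy hz hxy hxz hyz
    have h1 : ({x, y, z} : Set (BlockNode I × Fin 3)).ncard = 3 :=
      Set.ncard_eq_three.2 ⟨x, y, z, hxy, hxz, hyz, rfl⟩
    have h2 : ({x, y, z} : Set (BlockNode I × Fin 3)) ⊆ F := by
      rintro a (rfl | rfl | rfl) <;> assumption
    have := Set.ncard_le_ncard h2
    omega
  have hnotU : ∀ n, cmp n = some k → n ∉ U := by
    intro n hn hn'
    rw [(hU n).2 hn'] at hn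
    cases hn
  set Kv : V → Prop := fun v => ∃ i : {i : V × B // I i.1 i.2}, i.1.1 = v ∧ cmp (.inl i) = some k
    with hKv
  set Kb : B → Prop := fun b => ∃ i : {i : V × B // I i.1 i.2}, i.1.2 = b ∧ cmp (.inl i) = some k
    with hKb
  have hpoint : ∀ v, Kv v → pointComp U cmp v = some k := by
    rintro _ ⟨i, rfl, hi⟩
    rw [pointComp_eq hcmp (hnotU _ hi), hi]
  have hblock : ∀ b e, Kb b → blockComp U cmp (b, e) = some k := by
    rintro _ e ⟨i, rfl, hi⟩
    rw [blockComp_eq hcmp (hnotU _ hi), hi]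
  have hF0 : ∀ i, Sum.inl i ∈ U → Kv i.1.1 → (Sum.inl i, 0) ∈ F := fun i hi h =>
    ⟨hi, by simpa [token] using hpoint _ h⟩
  have hF1 : ∀ i, Sum.inl i ∈ U → Kb i.1.2 → (Sum.inl i, 1) ∈ F := fun i hi h =>
    ⟨hi, by simpa [token] using hblock _ _ h⟩
  have hF2 : ∀ i, Sum.inl i ∈ U → Kb i.1.2 → (Sum.inl i, 2) ∈ F := fun i hi h =>
    ⟨hi, by simpa [token] using hblock _ _ h⟩
  have hx : ∀ c, Kb c.1 → Sum.inr c ∉ U := by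
    intro c hc hcU
    have : ∀ j, (Sum.inr c, j) ∈ F := fun j => ⟨hcU, hblock c.1 c.2 hc⟩
    exact hthree _ _ _ (this 0) (this 1) (this 2) (by simp) (by simp) (by simp)
  have hinr : ∀ c, cmp (.inr c) = some k → Kb c.1 := by
    intro c hc
    by_contra hcon
    have hall : ∀ i : {i : V × B // I i.1 i.2}, i.1.2 = c.1 → .inl i ∈ U := by
      intro i hi
      by_contra hiU
      refine hcon ⟨i, hi, ?_⟩
      rw [hcmp _ _ hiU (hnotU _ hc) hi, hc]
    have hbc : blockComp U cmp c = some k := by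
      rw [blockComp, dif_neg, hc]
      rintro ⟨i, hi, hiU⟩
      exact hiU (hall i hi)
    obtain ⟨x, hx, y, hy, z, hz, hxy, hxz, hyz⟩ := (Set.two_lt_ncard (Set.toFinite _)).1 (hB c.1)
    have hmem : ∀ v (hv : I v c.1),
        (Sum.inl (⟨(v, c.1), hv⟩ : {i : V × B // I i.1 i.2}), if c.2 then (1 : Fin 3) else 2) ∈ F := by
      intro v hv
      refine ⟨hall _ rfl, ?_⟩
      rw [← hbc]
      obtain ⟨b, e⟩ := c
      cases e <;> simp [token]
    exact hthree _ _ _ (hmem x hx) (hmem y hy) (hmem z hz) (by simpa using hxy)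
      (by simpa using hxz) (by simpa using hyz)
  -- the removed incidences at points of the component
  set A : Set (BlockNode I) := {n | n ∈ U ∧ ∃ i, n = .inl i ∧ Kv i.1.1} with hA
  have hAodd : Odd A.ncard := by
    have hev := even_card_blockNodes I hI Kv Kb
    have hun : {n : BlockNode I | (∃ i, n = .inl i ∧ Kv i.1.1) ∨ ∃ c, n = .inr c ∧ Kb c.1} =
        {n | cmp n = some k} ∪ A := by
      ext n
      simp only [Set.mem_union, Set.mem_ofPred_eq, hA]
      constructor
      · rintro (⟨i, rfl, hi⟩ | ⟨c, rfl, hc⟩)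
        · by_cases hiU : Sum.inl i ∈ U
          · exact Or.inr ⟨hiU, i, rfl, hi⟩
          · left
            rw [← pointComp_eq hcmp hiU, hpoint _ hi]
        · left
          obtain ⟨i, hi, hik⟩ := hc
          rw [← hik]
          exact (hcmp _ _ (hnotU _ hik) (hx c ⟨i, hi, hik⟩) hi).symm
      · rintro (hn | ⟨-, i, rfl, hi⟩)
        · rcases n with i | c
          · exact Or.inl ⟨i, rfl, i, rfl, hn⟩
          · exact Or.inr ⟨c, rfl, hinr c hn⟩
        · exact Or.inl ⟨i, rfl, hi⟩
    have hdis : Disjoint {n | cmp n = some k} A := by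
      rw [Set.disjoint_left]
      exact fun n hn hnA => hnotU n hn hnA.1
    rw [hun, Set.ncard_union_eq hdis] at hev
    grind
  obtain ⟨n₀, hn₀U, i₀, rfl, hi₀⟩ : A.Nonempty := by
    rw [← Set.ncard_pos]
    exact hAodd.pos
  have hKbU : ∀ i, Sum.inl i ∈ U → ¬ Kb i.1.2 := fun i hi h =>
    hthree _ _ _ (hF0 i₀ hn₀U hi₀) (hF1 i hi h) (hF2 i hi h) (by simp) (by simp) (by simp)
  have hA1 : ∀ i, Sum.inl i ∈ U → Kv i.1.1 → i = i₀ := by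
    intro i hiU hi
    by_contra hne
    have h1 : A.ncard ≠ 1 := by
      intro h
      obtain ⟨n, hn⟩ := Set.ncard_eq_one.1 h
      have ha : Sum.inl i ∈ A := ⟨hiU, i, rfl, hi⟩
      have hb : Sum.inl i₀ ∈ A := ⟨hn₀U, i₀, rfl, hi₀⟩
      rw [hn] at ha hb
      exact hne (Sum.inl.inj (ha.trans hb.symm))
    have h3 : 2 < A.ncard := by
      obtain ⟨r, hr⟩ := hAodd
      omega
    obtain ⟨x, hx, y, hy, z, hz, hxy, hxz, hyz⟩ := (Set.two_lt_ncard (Set.toFinite _)).1 h3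
    obtain ⟨hxU, x, rfl, hx⟩ := hx
    obtain ⟨hyU, y, rfl, hy⟩ := hy
    obtain ⟨hzU, z, rfl, hz⟩ := hz
    exact hthree _ _ _ (hF0 x hxU hx) (hF0 y hyU hy) (hF0 z hzU hz) (by simpa using hxy)
      (by simpa using hxz) (by simpa using hyz)
  have hin : ∀ i : {i : V × B // I i.1 i.2}, Kv i.1.1 → i ≠ i₀ → cmp (.inl i) = some k := by
    intro i hi hne
    have hiU : Sum.inl i ∉ U := fun h => hne (hA1 i h hi)
    rw [← pointComp_eq hcmp hiU, hpoint _ hi]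
  obtain ⟨v, hv, b, hb, hvb, w, hwb, hw⟩ := hbridge {v | Kv v} i₀.1.1 i₀.1.2 hi₀ i₀.2 (by
    intro v hv hvb
    by_contra hne
    refine hKbU i₀ hn₀U ⟨⟨(v, i₀.1.2), hvb⟩, rfl, hin _ hv ?_⟩
    exact fun h => hne (congrArg (fun i => i.1.1) h))
  have hbK : Kb b := by
    refine ⟨⟨(v, b), hvb⟩, rfl, hin _ hv ?_⟩
    exact fun h => hb (congrArg (fun i => i.1.2) h)
  refine hw ⟨⟨(w, b), hwb⟩, rfl, ?_⟩
  have hwU : Sum.inl (⟨(w, b), hwb⟩ : {i : V × B // I i.1 i.2}) ∉ U := fun h => hKbU _ h hbK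
  rw [← blockComp_eq hcmp hwU true, hblock _ _ hbK]

end Tokens

/-- In a block system in which every point lies in an even number of blocks, every block has at
least three points, and no set of points is attached to the rest by a single incidence, one can
select incidences, evenly many at each point, so that the omitted ones are even and positive in
number at each block. -/
lemma exists_even_selection [Fintype V] [Fintype B] (hI : ∀ v, Even {b | I v b}.ncard)
    (hB : ∀ b, 3 ≤ {v | I v b}.ncard)
    (hbridge : ∀ (A : Set V) (v₀ : V) (b₀ : B), v₀ ∈ A → I v₀ b₀ →
      (∀ v ∈ A, I v b₀ → v = v₀) → ∃ v ∈ A, ∃ b ≠ b₀, I v b ∧ ∃ w, I w b ∧ w ∉ A) :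
    ∃ p : V → B → Prop, (∀ v, Even {b | I v b ∧ p v b}.ncard) ∧
      ∀ b, Even {v | I v b ∧ ¬ p v b}.ncard ∧ ∃ v, I v b ∧ ¬ p v b := by
  classical
  obtain ⟨f, hf, hff⟩ := exists_matching_involution (blockGraph I) (by
    intro U cmp hU hcmp
    set S := {k | Odd {n | cmp n = some k}.ncard} with hS
    have hfib : ∀ k ∈ S.toFinset, 3 ≤ (((U.toFinset ×ˢ (Finset.univ : Finset (Fin 3))).filter
        fun x => token U cmp x = some k)).card := by
      intro k hk
      rw [← Set.ncard_coe_finset]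
      convert three_le_card_token hI hB hbridge hU hcmp k (by simpa [hS] using hk) using 2
      ext x
      simp
    have h1 := Finset.card_nsmul_le_sum _ _ 3 hfib
    have h2 : ∑ k ∈ S.toFinset, (((U.toFinset ×ˢ (Finset.univ : Finset (Fin 3))).filter
        fun x => token U cmp x = some k)).card ≤
        (U.toFinset ×ˢ (Finset.univ : Finset (Fin 3))).card := by
      rw [← Finset.card_biUnion]
      · refine Finset.card_le_card fun x hx => ?_
        obtain ⟨k, -, hk⟩ := Finset.mem_biUnion.1 hx
        exact (Finset.mem_filter.1 hk).1
      · intro k _ l _ hkl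
        rw [Function.onFun, Finset.disjoint_left]
        intro x hx hy
        have := (Finset.mem_filter.1 hx).2.symm.trans (Finset.mem_filter.1 hy).2
        exact hkl (Option.some.inj this)
    rw [Finset.card_product, Finset.card_univ, Fintype.card_fin] at h2
    rw [Set.ncard_eq_toFinset_card', Set.ncard_eq_toFinset_card']
    simp only [smul_eq_mul] at h1
    omega)
  set same : {i : V × B // I i.1 i.2} → Prop := fun i => ∃ j, f (.inl i) = .inl j ∧ j.1.1 = i.1.1
    with hsame
  refine ⟨fun v b => ∃ h : I v b, same ⟨(v, b), h⟩, fun v => ?_, fun b => ?_⟩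
  · set T : Set {i : V × B // I i.1 i.2} := {i | i.1.1 = v ∧ same i} with hT
    have hb : {b | I v b ∧ ∃ h : I v b, same ⟨(v, b), h⟩} = (fun i => i.1.2) '' T := by
      ext b
      constructor
      · rintro ⟨-, h, hs⟩
        exact ⟨⟨(v, b), h⟩, ⟨rfl, hs⟩, rfl⟩
      · rintro ⟨⟨⟨v', b'⟩, h⟩, ⟨rfl, hs⟩, rfl⟩
        exact ⟨h, h, hs⟩
    rw [hb, Set.InjOn.ncard_image]
    · set g : {i : V × B // I i.1 i.2} → {i : V × B // I i.1 i.2} :=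
        fun i => Sum.elim id (fun _ => i) (f (.inl i)) with hg
      have hgT : ∀ i ∈ T, f (.inl i) = .inl (g i) ∧ (g i).1.1 = i.1.1 := by
        rintro i ⟨-, j, hj, hji⟩
        simp [hg, hj, hji]
      have hfg : ∀ i ∈ T, f (.inl (g i)) = .inl i := by
        intro i hi
        rw [← (hgT i hi).1, hff]
      refine even_ncard_of_involution T g (fun i hi => ?_) (fun i hi h => ?_) (fun i hi => ?_)
      · exact ⟨(hgT i hi).2.trans hi.1, i, hfg i hi, (hgT i hi).2.symm⟩
      · have h1 := hf (.inl i)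
        rw [(hgT i hi).1, h] at h1
        exact (blockGraph I).loopless.1 _ h1
      · have := hfg i hi
        simp only [hg] at this ⊢
        rw [this]
        rfl
    · rintro ⟨⟨v₁, b₁⟩, h₁⟩ ⟨rfl, -⟩ ⟨⟨v₂, b₂⟩, h₂⟩ ⟨h, -⟩ h'
      simp only at h h'
      subst h h'
      rfl
  · set T : Set {i : V × B // I i.1 i.2} := {i | i.1.2 = b ∧ ¬ same i} with hT
    have hvT : {v | I v b ∧ ¬ ∃ h : I v b, same ⟨(v, b), h⟩} = (fun i => i.1.1) '' T := by
      ext v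
      constructor
      · rintro ⟨h, hs⟩
        exact ⟨⟨(v, b), h⟩, ⟨rfl, fun h' => hs ⟨h, h'⟩⟩, rfl⟩
      · rintro ⟨⟨⟨v', b'⟩, h⟩, ⟨rfl, hs⟩, rfl⟩
        exact ⟨h, fun ⟨_, h'⟩ => hs h'⟩
    have hinj : Set.InjOn (fun i : {i : V × B // I i.1 i.2} => i.1.1) T := by
      rintro ⟨⟨v₁, b₁⟩, h₁⟩ ⟨rfl, -⟩ ⟨⟨v₂, b₂⟩, h₂⟩ ⟨h, -⟩ h'
      simp only at h h'
      subst h h'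
      rfl
    have hextra : ∀ e, ∃ i ∈ T, f (.inr (b, e)) = .inl i := by
      intro e
      have h1 := hf (.inr (b, e))
      have h2 := hff (.inr (b, e))
      rcases hfe : f (.inr (b, e)) with i | c
      · rw [hfe] at h1 h2
        refine ⟨i, ⟨h1, ?_⟩, rfl⟩
        rintro ⟨j, hj, -⟩
        rw [h2] at hj
        cases hj
      · rw [hfe] at h1
        exact h1.elim
    constructor
    · rw [hvT, hinj.ncard_image]
      have hS : Even (Sum.inl '' T ∪ Sum.inr '' {(b, false), (b, true)} : Set (BlockNode I)).ncard := by
        refine even_ncard_of_involution _ f ?_ (fun n _ h => ?_) (fun n _ => hff n)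
        · rintro _ (⟨i, ⟨rfl, hi⟩, rfl⟩ | ⟨⟨b', e⟩, hc, rfl⟩)
          · have h1 := hf (.inl i)
            have h2 := hff (.inl i)
            rcases hfe : f (.inl i) with j | ⟨b', e⟩
            · rw [hfe] at h1 h2
              have hij : i.1.1 ≠ j.1.1 := fun h => hi ⟨j, hfe, h.symm⟩
              refine Or.inl ⟨j, ⟨(h1.2.resolve_left hij).symm, ?_⟩, rfl⟩
              rintro ⟨l, hl, hlj⟩
              rw [h2] at hl
              cases hl
              exact hij hlj
            · rw [hfe] at h1
              have h1 : i.1.2 = b' := h1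
              subst h1
              cases e <;> simp
          · have : b' = b := by
              rcases hc with h | h <;> exact congrArg Prod.fst h
            subst this
            obtain ⟨i, hi, hfi⟩ := hextra e
            exact Or.inl ⟨i, hi, hfi.symm⟩
        · have h1 := hf n
          rw [h] at h1
          exact (blockGraph I).loopless.1 _ h1
      rw [Set.ncard_union_eq, Set.ncard_image_of_injective _ Sum.inl_injective,
        Set.ncard_image_of_injective _ Sum.inr_injective, Set.ncard_pair (by simp)] at hS
      · grind
      · rw [Set.disjoint_left]
        rintro _ ⟨i, -, rfl⟩ ⟨c, -, hc⟩
        cases hc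
    · obtain ⟨i, hi, -⟩ := hextra true
      have : i.1.1 ∈ {v | I v b ∧ ¬ ∃ h : I v b, same ⟨(v, b), h⟩} := hvT ▸ ⟨i, hi, rfl⟩
      exact ⟨_, this⟩

end Blocks

lemma exists_crossing_adj {H : SimpleGraph V} (A : Set V) {x y : V} (h : H.Reachable x y)
    (hx : x ∈ A) (hy : y ∉ A) : ∃ u w, H.Adj u w ∧ u ∈ A ∧ w ∉ A := by
  obtain ⟨p⟩ := h
  obtain ⟨d, -, h1, h2⟩ := p.exists_boundary_dart A hx hy
  exact ⟨d.fst, d.snd, d.adj, h1, h2⟩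

lemma IsCycleSG.three_le_ncard_verts [Finite V] {G : SimpleGraph V} {O : G.Subgraph}
    (hO : IsCycleSG O) : 3 ≤ O.verts.ncard := by
  obtain ⟨v, hv⟩ := hO.1.nonempty
  have hnot : v ∉ O.neighborSet v := fun h => O.loopless.1 v h
  have hsub : insert v (O.neighborSet v) ⊆ O.verts := by
    rintro u (rfl | hu)
    exacts [hv, O.edge_vert hu.symm]
  have h2 : (O.neighborSet v).ncard = 2 := hO.2 v hv
  have := Set.ncard_le_ncard hsub
  rw [Set.ncard_insert_of_notMem hnot] at this
  omega

/-- A 3-connected 2t-regular graph (`t` even, `t ≥ 2`) with a set of pairwise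
edge-disjoint cycles of length at least 3 admits an orientation with all indegrees even
in which no cycle of the set is an oriented cycle. -/
theorem stmt_11 {V : Type*} [Fintype V] (t : ℕ) (ht : 2 ≤ t) (hte : Even t)
    (G : SimpleGraph V)
    (hconn : KConnected 3 G) (hreg : IsRegular G (2 * t))
    (𝒪 : Set G.Subgraph) (hcyc : ∀ O ∈ 𝒪, IsCycleSG O ∧ 3 ≤ O.edgeSet.ncard)
    (hdisj : PairwiseEdgeDisjoint 𝒪) :
    ∃ D : Orient G, (∀ v : V, Even (indeg D v)) ∧
      ∀ O ∈ 𝒪, ¬ IsOrientedCycle D O := by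
  classical
  obtain ⟨𝒟, hsub, hc, hd, hcover⟩ :=
    exists_cycle_decomposition t hreg 𝒪 (fun O hO => (hcyc O hO).1) hdisj
  have hadj : ∀ u v, G.Adj u v ↔ ∃ O ∈ 𝒟, O.Adj u v :=
    fun u v => ⟨hcover u v, fun ⟨O, _, h⟩ => h.adj_sub⟩
  have hnum : ∀ v, {O | O ∈ 𝒟 ∧ v ∈ O.verts}.ncard = t := by
    intro v
    have h1 := ncard_covered_neighbors hc hd v
    have h2 := hreg v
    have h3 : G.neighborSet v = {u | ∃ O ∈ 𝒟, O.Adj v u} := by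
      ext u
      exact hadj v u
    rw [h3] at h2
    omega
  have : Fintype 𝒟 := Fintype.ofFinite 𝒟
  have hnum' : ∀ v, {b : 𝒟 | v ∈ b.1.verts}.ncard = t := by
    intro v
    rw [← hnum v, ← Set.ncard_image_of_injective _ Subtype.val_injective]
    congr 1
    ext O
    simp [and_comm]
  obtain ⟨p, hpv, hpb⟩ := exists_even_selection (V := V) (B := 𝒟) (I := fun v b => v ∈ b.1.verts)
    (fun v => by rw [hnum' v]; exact hte) (fun b => (hc _ b.2).three_le_ncard_verts) (by
      intro A v₀ b₀ hv₀ hvb hA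
      by_contra! hcon
      obtain ⟨w, hw, hwv⟩ := (Set.one_lt_ncard_iff_nontrivial.1 (lt_of_lt_of_le (by norm_num)
        (hc _ b₀.2).three_le_ncard_verts)).exists_ne v₀
      have hwA : w ∉ A := fun h => hwv (hA w h hw)
      obtain ⟨b₁, hb₁, hb₁₀⟩ := (Set.one_lt_ncard_iff_nontrivial.1
        (by rw [hnum' v₀]; omega : 1 < {b : 𝒟 | v₀ ∈ b.1.verts}.ncard)).exists_ne b₀
      obtain ⟨x, hx, hxv⟩ := (Set.one_lt_ncard_iff_nontrivial.1 (lt_of_lt_of_le (by norm_num)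
        (hc _ b₁.2).three_le_ncard_verts)).exists_ne v₀
      have hxA : x ∈ A := hcon v₀ hv₀ b₁ hb₁₀ hb₁ x hx
      have hcut := (hconn.2 {v₀} (by simp)).preconnected ⟨x, hxv⟩ ⟨w, hwv⟩
      obtain ⟨⟨u, hu⟩, ⟨y, hy⟩, huy, huA, hyA⟩ :=
        exists_crossing_adj (Subtype.val ⁻¹' A) hcut hxA hwA
      obtain ⟨O, hO, hOuy⟩ := hcover u y huy
      refine hyA (hcon u huA ⟨O, hO⟩ ?_ hOuy.fst_mem y hOuy.snd_mem)
      rintro rfl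
      exact hu (hA u huA hOuy.fst_mem))
  have hD : ∀ b : 𝒟, ∃ D : Orient b.1.spanningCoe,
      ∀ v ∈ b.1.verts, (Even (indeg D v) ↔ ¬ p v b) :=
    fun b => (hc _ b.2).exists_orient_indeg (fun v => p v b) (hpb b).1
  choose D hD using hD
  have hDadj : ∀ b u v, (D b).dir u v → b.1.Adj u v :=
    fun b u v h => ((D b).adj_iff u v).2 (Or.inl h)
  have huniq : ∀ b b' : 𝒟, ∀ u v, b.1.Adj u v → b'.1.Adj u v → b = b' := by
    intro b b' u v h h'
    by_contra hne
    exact subgraph_edge_disjoint_iff.1 (hd b.2 b'.2 (fun h => hne (Subtype.ext h))) u v h h'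
  let E : Orient G :=
    { dir := fun u v => ∃ b, (D b).dir u v
      adj_iff := fun u v => by
        rw [hadj]
        constructor
        · rintro ⟨O, hO, h⟩
          exact (((D ⟨O, hO⟩).adj_iff u v).1 h).imp (fun h => ⟨_, h⟩) (fun h => ⟨_, h⟩)
        · rintro (⟨b, h⟩ | ⟨b, h⟩)
          exacts [⟨b, b.2, hDadj b u v h⟩, ⟨b, b.2, (hDadj b v u h).symm⟩]
      asymm := by
        rintro u v ⟨b, h⟩ ⟨b', h'⟩
        obtain rfl := huniq b b' u v (hDadj b u v h) (hDadj b' v u h').symm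
        exact (D b).asymm u v h h' }
  refine ⟨E, fun v => ?_, fun O hO hor => ?_⟩
  · have h1 : indeg E v = ∑ b : 𝒟, indeg (D b) v := by
      have := ncard_exists_mem_eq_sum (Finset.univ : Finset 𝒟) (fun b u => (D b).dir u v)
        (fun b _ b' _ hne u h h' => hne (huniq b b' u v (hDadj _ _ _ h) (hDadj _ _ _ h')))
      simpa [indeg, E] using this
    have h2 : ∀ b : 𝒟, (indeg (D b) v : ZMod 2) = if v ∈ b.1.verts ∧ p v b then 1 else 0 := by
      intro b
      by_cases hv : v ∈ b.1.verts
      · by_cases hp : p v b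
        · rw [if_pos ⟨hv, hp⟩, ZMod.natCast_eq_one_iff_odd, ← Nat.not_even_iff_odd, hD b v hv]
          exact not_not.2 hp
        · rw [if_neg (fun h => hp h.2), ZMod.natCast_eq_zero_iff_even, hD b v hv]
          exact hp
      · have : indeg (D b) v = 0 := by
          unfold indeg
          rw [Set.ncard_eq_zero]
          ext u
          simp only [Set.mem_ofPred_eq, Set.mem_empty_iff_false, iff_false]
          exact fun h => hv (hDadj b u v h).snd_mem
        simp [this, hv]
    have h3 := hpv v
    rw [Set.ncard_eq_toFinset_card', ← ZMod.natCast_eq_zero_iff_even] at h3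
    rw [h1, ← ZMod.natCast_eq_zero_iff_even, Nat.cast_sum, Finset.sum_congr rfl fun b _ => h2 b,
      Finset.sum_boole, ← h3]
    simp
  · obtain ⟨v, hv, hpv'⟩ := (hpb ⟨O, hsub hO⟩).2
    have heven := (hD ⟨O, hsub hO⟩ v hv).2 hpv'
    obtain ⟨u, ⟨huO, b, hb⟩, hu⟩ := hor v hv
    have hset : {w | (D ⟨O, hsub hO⟩).dir w v} = {u} := by
      ext w
      simp only [Set.mem_ofPred_eq, Set.mem_singleton_iff]
      constructor
      · exact fun h => hu w ⟨hDadj _ _ _ h, _, h⟩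
      · rintro rfl
        obtain rfl := huniq ⟨O, hsub hO⟩ b w v huO (hDadj _ _ _ hb)
        exact hb
    unfold indeg at heven
    rw [hset, Set.ncard_singleton] at heven
    exact absurd heven (by decide)

end PaperFormalization
end

section
/- Let t ≥ 2 be an even integer and let G be a 2-connected 2t-regular finite simple graph. Let 𝒪 be a set of pairwise edge-disjoint odd cycles of G. Then for every integer l with t ≤ l ≤ 2t and l ≡ t (mod 2), there exists an l-factor F of G such that E(F) ∩ E(O) ≠ ∅ for every O ∈ 𝒪. -/
open SimpleGraph

namespace PaperFormalization

variable {V : Type*}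

/-- Tutte's theorem with the odd components replaced by an arbitrary disjoint family of odd sets
closed under adjacency. -/
theorem exists_adj_involution_of_closed_family_card_le {W : Type*} [Fintype W] [DecidableEq W]
    (A : SimpleGraph W)
    (h : ∀ (U : Finset W) (𝒦 : Finset (Finset W)),
      (∀ K ∈ 𝒦, ∀ L ∈ 𝒦, ∀ w, w ∈ K → w ∈ L → K = L) → (∀ K ∈ 𝒦, Odd K.card) →
      (∀ K ∈ 𝒦, ∀ w ∈ K, w ∉ U) →
      (∀ K ∈ 𝒦, ∀ w ∈ K, ∀ w', A.Adj w w' → w' ∉ U → w' ∈ K) → 𝒦.card ≤ U.card) :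
    ∃ f : W → W, Function.Involutive f ∧ ∀ w, A.Adj w (f w) := by
  classical
  have hT : ∃ M : Subgraph A, M.IsPerfectMatching := by
    rw [SimpleGraph.tutte]
    intro u hu
    unfold IsTutteViolator at hu
    set H := ((⊤ : A.Subgraph).deleteVerts u).coe with hH
    let F : H.ConnectedComponent → Finset W := fun c =>
      (Subtype.val '' c.supp).toFinset
    have hF : ∀ c w, w ∈ F c ↔ ∃ hw, H.connectedComponentMk ⟨w, hw⟩ = c := by
      intro c w
      simp [F]
    have hcard : ∀ c, (F c).card = c.supp.ncard := by
      intro c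
      rw [← Set.ncard_eq_toFinset_card', Set.ncard_image_of_injective _ Subtype.val_injective]
    have hinj : Function.Injective F := by
      intro c d hcd
      obtain ⟨x, hx⟩ := c.nonempty_supp
      have h1 : x.1 ∈ F c := (hF _ _).2 ⟨x.2, hx⟩
      rw [hcd, hF] at h1
      obtain ⟨_, h1⟩ := h1
      exact hx.symm.trans h1
    have key := h u.toFinset (H.oddComponents.toFinset.image F) ?_ ?_ ?_ ?_
    · rw [Finset.card_image_of_injective _ hinj, ← Set.ncard_eq_toFinset_card',
        ← Set.ncard_eq_toFinset_card'] at key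
      omega
    · simp only [Finset.mem_image]
      rintro _ ⟨c, -, rfl⟩ _ ⟨d, -, rfl⟩ w hc hd
      obtain ⟨_, hc⟩ := (hF _ _).1 hc
      obtain ⟨_, hd⟩ := (hF _ _).1 hd
      rw [← hc, ← hd]
    · simp only [Finset.mem_image]
      rintro _ ⟨c, hc, rfl⟩
      rw [hcard]
      simpa using hc
    · simp only [Finset.mem_image]
      rintro _ ⟨c, -, rfl⟩ w hw
      obtain ⟨hw', -⟩ := (hF _ _).1 hw
      simpa using hw'.2
    · simp only [Finset.mem_image]
      rintro _ ⟨c, -, rfl⟩ w hw w' hadj hw'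
      obtain ⟨hw₁, rfl⟩ := (hF _ _).1 hw
      have hw'' : w' ∈ ((⊤ : A.Subgraph).deleteVerts u).verts := by simpa using hw'
      refine (hF _ _).2 ⟨hw'', ?_⟩
      refine (ConnectedComponent.sound (SimpleGraph.Adj.reachable ?_))
      have h3 : w ∉ u := hw₁.2
      have h4 : w' ∉ u := hw''.2
      simp [hH, h3, h4, hadj.symm]
  obtain ⟨M, hM, hs⟩ := hT
  choose f hf hf' using fun w => hM (hs w)
  exact ⟨f, fun w => (hf' _ _ (hf w).symm).symm, fun w => (hf w).adj_sub⟩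

/-- A finite set partitioned by `v` into fibres of even size has even size. -/
theorem even_card_of_saturated {X S : Type*} [Fintype X] [DecidableEq X] [DecidableEq S]
    (v : X → S) (hv : ∀ s, Even (Finset.univ.filter fun x => v x = s).card) (Y : Finset X)
    (hY : ∀ x ∈ Y, ∀ y, v y = v x → y ∈ Y) : Even Y.card := by
  rw [Finset.card_eq_sum_card_image v Y]
  refine Finset.even_sum _ fun s hs => ?_
  obtain ⟨x, hx, rfl⟩ := Finset.mem_image.1 hs
  have : (Y.filter fun y => v y = v x) = Finset.univ.filter fun y => v y = v x := by
    ext y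
    simpa using hY x hx y
  rw [this]
  exact hv _

theorem sum_card_le_of_unique {ι α : Type*} [DecidableEq α] (s : Finset ι) (f : ι → Finset α)
    (B : Finset α) (hB : ∀ i ∈ s, f i ⊆ B)
    (hf : ∀ i ∈ s, ∀ j ∈ s, ∀ a, a ∈ f i → a ∈ f j → i = j) :
    ∑ i ∈ s, (f i).card ≤ B.card := by
  rw [← Finset.card_biUnion]
  · exact Finset.card_le_card (Finset.biUnion_subset.2 hB)
  · intro i hi j hj hij
    exact Finset.disjoint_left.2 fun a ha hb => hij (hf i hi j hj a ha hb)

/-- The gadget graph: elements of `X` are joined when they agree under `v` or under `c`, and every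
fibre of `c` gets two additional mutually nonadjacent vertices joined to the whole fibre. -/
def gadgetGraph {X S T : Type*} (v : X → S) (c : X → T) : SimpleGraph (X ⊕ T × Bool) where
  Adj
    | .inl x, .inl y => x ≠ y ∧ (v x = v y ∨ c x = c y)
    | .inl x, .inr τ => c x = τ.1
    | .inr τ, .inl x => c x = τ.1
    | .inr _, .inr _ => False
  symm := ⟨by
    rintro (x | x) (y | y) h
    · exact ⟨h.1.symm, h.2.imp Eq.symm Eq.symm⟩
    · exact h
    · exact h
    · exact h⟩
  loopless := ⟨by
    rintro (x | x) h
    · exact h.1 rfl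
    · exact h⟩

theorem closed_family_card_le {X S T : Type*} [Fintype X] [DecidableEq X] [Fintype T]
    [DecidableEq S] [DecidableEq T] (v : X → S) (c : X → T)
    (hv : ∀ s, Even (Finset.univ.filter fun x => v x = s).card)
    (hc : ∀ τ, 3 ≤ (Finset.univ.filter fun x => c x = τ).card)
    (hcut : ∀ (Y : Finset X) (u : X), Y.Nonempty → (∀ x ∈ Y, ∀ y, c y = c x → y ∈ Y) → u ∉ Y →
      (∃ y ∈ Y, v y = v u) → (∀ y ∈ Y, ∀ x, v x = v y → x ∈ Y ∨ x = u) → False)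
    (U : Finset (X ⊕ T × Bool)) (𝒦 : Finset (Finset (X ⊕ T × Bool)))
    (hdis : ∀ K ∈ 𝒦, ∀ L ∈ 𝒦, ∀ w, w ∈ K → w ∈ L → K = L) (hodd : ∀ K ∈ 𝒦, Odd K.card)
    (hKU : ∀ K ∈ 𝒦, ∀ w ∈ K, w ∉ U)
    (hcl : ∀ K ∈ 𝒦, ∀ w ∈ K, ∀ w', (gadgetGraph v c).Adj w w' → w' ∉ U → w' ∈ K) :
    𝒦.card ≤ U.card := by
  classical
  let dead : T → Prop := fun τ => ∀ x, c x = τ → Sum.inl x ∈ U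
  let KX : Finset (X ⊕ T × Bool) → Finset X := fun K => K.toLeft
  let P : Finset (X ⊕ T × Bool) → Finset X := fun K =>
    U.toLeft.filter fun x => ∃ y ∈ K.toLeft, v y = v x
  let Z : Finset (X ⊕ T × Bool) → Finset X := fun K =>
    U.toLeft.filter fun x => ∃ y ∈ K.toLeft, c y = c x
  let R : Finset (X ⊕ T × Bool) → Finset (T × Bool) := fun K =>
    U.toRight.filter fun τ => ∃ y ∈ K.toLeft, c y = τ.1
  let bad : Finset (X ⊕ T × Bool) → Prop := fun K => ∃ τ ∈ K.toRight, dead τ.1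
  have hvK : ∀ K ∈ 𝒦, ∀ x ∈ K.toLeft, ∀ y, v y = v x → Sum.inl y ∉ U → y ∈ K.toLeft := by
    intro K hK x hx y hxy hyU
    by_cases h : y = x
    · rwa [h]
    · rw [Finset.mem_toLeft] at hx ⊢
      exact hcl K hK _ hx _ ⟨Ne.symm h, Or.inl hxy.symm⟩ hyU
  have hcK : ∀ K ∈ 𝒦, ∀ x ∈ K.toLeft, ∀ y, c y = c x → Sum.inl y ∉ U → y ∈ K.toLeft := by
    intro K hK x hx y hxy hyU
    by_cases h : y = x
    · rwa [h]
    · rw [Finset.mem_toLeft] at hx ⊢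
      exact hcl K hK _ hx _ ⟨Ne.symm h, Or.inr hxy.symm⟩ hyU
  have hdisX : ∀ K ∈ 𝒦, ∀ L ∈ 𝒦, ∀ x, x ∈ K.toLeft → x ∈ L.toLeft → K = L := by
    intro K hK L hL x hx hy
    exact hdis K hK L hL _ (Finset.mem_toLeft.1 hx) (Finset.mem_toLeft.1 hy)
  have hnotU : ∀ K ∈ 𝒦, ∀ x ∈ K.toLeft, Sum.inl x ∉ U := fun K hK x hx =>
    hKU K hK _ (Finset.mem_toLeft.1 hx)
  have hgood : ∀ K ∈ 𝒦.filter fun K => ¬ bad K, 3 ≤ (P K).card + 2 * (Z K).card + 3 * (R K).card := by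
    intro K hK
    obtain ⟨hK, hKb⟩ := Finset.mem_filter.1 hK
    have hP : Even (K.toLeft.card + (P K).card) := by
      rw [← Finset.card_union_of_disjoint]
      · apply even_card_of_saturated v hv
        intro x hx y hxy
        have : ∃ z ∈ K.toLeft, v z = v x := by
          rcases Finset.mem_union.1 hx with hx | hx
          · exact ⟨x, hx, rfl⟩
          · exact (Finset.mem_filter.1 hx).2
        obtain ⟨z, hz, hzx⟩ := this
        by_cases hyU : Sum.inl y ∈ U
        · exact Finset.mem_union_right _ (Finset.mem_filter.2
            ⟨Finset.mem_toLeft.2 hyU, z, hz, hzx.trans hxy.symm⟩)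
        · exact Finset.mem_union_left _ (hvK K hK z hz y (hxy.trans hzx.symm) hyU)
      · refine Finset.disjoint_left.2 fun x hx hx' => hnotU K hK x hx ?_
        exact Finset.mem_toLeft.1 (Finset.mem_filter.1 hx').1
    have hR : Even (K.toRight.card + (R K).card) := by
      rw [← Finset.card_union_of_disjoint]
      · have : K.toRight ∪ R K = (K.toLeft.image c) ×ˢ Finset.univ := by
          ext τ
          simp only [Finset.mem_union, Finset.mem_product, Finset.mem_image, Finset.mem_univ,
            and_true]
          constructor
          · rintro (h | h)
            · have h1 : ¬ dead τ.1 := fun hd => hKb ⟨τ, h, hd⟩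
              simp only [dead, not_forall] at h1
              obtain ⟨x, hx, hxU⟩ := h1
              refine ⟨x, Finset.mem_toLeft.2 (hcl K hK _ (Finset.mem_toRight.1 h) _ hx hxU), hx⟩
            · exact (Finset.mem_filter.1 h).2
          · rintro ⟨x, hx, hxτ⟩
            by_cases hU : Sum.inr τ ∈ U
            · exact Or.inr (Finset.mem_filter.2 ⟨Finset.mem_toRight.2 hU, x, hx, hxτ⟩)
            · exact Or.inl (Finset.mem_toRight.2
                (hcl K hK _ (Finset.mem_toLeft.1 hx) _ hxτ hU))
        rw [this, Finset.card_product]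
        simp
      · refine Finset.disjoint_left.2 fun x hx hx' => hKU K hK _ (Finset.mem_toRight.1 hx) ?_
        exact Finset.mem_toRight.1 (Finset.mem_filter.1 hx').1
    have hKo := hodd K hK
    rw [← Finset.card_toLeft_add_card_toRight] at hKo
    by_contra hlt
    have hR0 : (R K).card = 0 := by omega
    have hP1 : (P K).card = 1 := by
      rw [Nat.odd_iff] at hKo
      rw [Nat.even_iff] at hP hR
      omega
    have hZ0 : (Z K).card = 0 := by omega
    obtain ⟨u, hu⟩ := Finset.card_eq_one.1 hP1
    have huP : u ∈ P K := by rw [hu]; exact Finset.mem_singleton_self u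
    obtain ⟨huU, y, hy, hyu⟩ := Finset.mem_filter.1 huP
    refine hcut K.toLeft u ⟨y, hy⟩ ?_ ?_ ⟨y, hy, hyu⟩ ?_
    · intro x hx z hz
      by_contra hzK
      have hzU : Sum.inl z ∈ U := by
        by_contra hzU
        exact hzK (hcK K hK x hx z hz hzU)
      have : z ∈ Z K := Finset.mem_filter.2 ⟨Finset.mem_toLeft.2 hzU, x, hx, hz.symm⟩
      rw [Finset.card_eq_zero.1 hZ0] at this
      exact Finset.notMem_empty _ this
    · exact fun h => hnotU K hK u h (Finset.mem_toLeft.1 huU)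
    · intro z hz x hx
      by_cases hxU : Sum.inl x ∈ U
      · right
        have : x ∈ P K := Finset.mem_filter.2 ⟨Finset.mem_toLeft.2 hxU, z, hz, hx.symm⟩
        rw [hu] at this
        exact Finset.mem_singleton.1 this
      · exact Or.inl (hvK K hK z hz x hx hxU)
  have hPs : ∑ K ∈ 𝒦.filter (fun K => ¬ bad K), (P K).card ≤ U.toLeft.card := by
    refine sum_card_le_of_unique _ _ _ (fun K _ => Finset.filter_subset _ _) ?_
    intro K hK L hL x hx hx'
    obtain ⟨_, y, hy, hyx⟩ := Finset.mem_filter.1 hx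
    obtain ⟨_, z, hz, hzx⟩ := Finset.mem_filter.1 hx'
    have hK := (Finset.mem_filter.1 hK).1
    have hL := (Finset.mem_filter.1 hL).1
    exact hdisX K hK L hL z (hvK K hK y hy z (hzx.trans hyx.symm) (hnotU L hL z hz)) hz
  have hZs : ∑ K ∈ 𝒦.filter (fun K => ¬ bad K), (Z K).card ≤
      (U.toLeft.filter fun x => ¬ dead (c x)).card := by
    refine sum_card_le_of_unique _ _ _ ?_ ?_
    · intro K hK x hx
      obtain ⟨hxU, y, hy, hyx⟩ := Finset.mem_filter.1 hx
      exact Finset.mem_filter.2 ⟨hxU, fun hd =>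
        hnotU K (Finset.mem_filter.1 hK).1 y hy (hd y hyx)⟩
    intro K hK L hL x hx hx'
    obtain ⟨_, y, hy, hyx⟩ := Finset.mem_filter.1 hx
    obtain ⟨_, z, hz, hzx⟩ := Finset.mem_filter.1 hx'
    have hK := (Finset.mem_filter.1 hK).1
    have hL := (Finset.mem_filter.1 hL).1
    exact hdisX K hK L hL z (hcK K hK y hy z (hzx.trans hyx.symm) (hnotU L hL z hz)) hz
  have hRs : ∑ K ∈ 𝒦.filter (fun K => ¬ bad K), (R K).card ≤
      (U.toRight.filter fun τ => ¬ dead τ.1).card := by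
    refine sum_card_le_of_unique _ _ _ ?_ ?_
    · intro K hK x hx
      obtain ⟨hxU, y, hy, hyx⟩ := Finset.mem_filter.1 hx
      exact Finset.mem_filter.2 ⟨hxU, fun hd =>
        hnotU K (Finset.mem_filter.1 hK).1 y hy (hd y hyx)⟩
    intro K hK L hL x hx hx'
    obtain ⟨_, y, hy, hyx⟩ := Finset.mem_filter.1 hx
    obtain ⟨_, z, hz, hzx⟩ := Finset.mem_filter.1 hx'
    have hK := (Finset.mem_filter.1 hK).1
    have hL := (Finset.mem_filter.1 hL).1
    exact hdisX K hK L hL z (hcK K hK y hy z (hzx.trans hyx.symm) (hnotU L hL z hz)) hz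
  have hbad : (𝒦.filter bad).card ≤ 2 * (Finset.univ.filter dead).card := by
    have h1 : ∑ K ∈ 𝒦.filter bad, (K.toRight.filter fun τ => dead τ.1).card ≤
        ((Finset.univ.filter dead) ×ˢ (Finset.univ : Finset Bool)).card := by
      refine sum_card_le_of_unique _ _ _ ?_ ?_
      · intro K _ τ hτ
        simpa using (Finset.mem_filter.1 hτ).2
      · intro K hK L hL τ hτ hτ'
        exact hdis K (Finset.mem_filter.1 hK).1 L (Finset.mem_filter.1 hL).1 _
          (Finset.mem_toRight.1 (Finset.mem_filter.1 hτ).1)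
          (Finset.mem_toRight.1 (Finset.mem_filter.1 hτ').1)
    rw [Finset.card_product] at h1
    have h2 : (𝒦.filter bad).card • 1 ≤
        ∑ K ∈ 𝒦.filter bad, (K.toRight.filter fun τ => dead τ.1).card := by
      refine Finset.card_nsmul_le_sum _ _ _ fun K hK => ?_
      obtain ⟨τ, hτ, hd⟩ := (Finset.mem_filter.1 hK).2
      exact Finset.card_pos.2 ⟨τ, Finset.mem_filter.2 ⟨hτ, hd⟩⟩
    simp at h1 h2
    omega
  have hdead : (Finset.univ.filter dead).card * 3 ≤
      (U.toLeft.filter fun x => dead (c x)).card := by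
    have h1 : ∑ τ ∈ Finset.univ.filter dead, (Finset.univ.filter fun x => c x = τ).card ≤
        (U.toLeft.filter fun x => dead (c x)).card := by
      refine sum_card_le_of_unique _ _ _ ?_ ?_
      · intro τ hτ x hx
        have hx := (Finset.mem_filter.1 hx).2
        have hτ := (Finset.mem_filter.1 hτ).2
        refine Finset.mem_filter.2 ⟨Finset.mem_toLeft.2 (hτ x hx), ?_⟩
        rwa [hx]
      · intro τ _ σ _ x hx hx'
        exact (Finset.mem_filter.1 hx).2.symm.trans (Finset.mem_filter.1 hx').2
    exact (Finset.card_nsmul_le_sum _ _ _ fun τ _ => hc τ).trans h1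
  have hsum : (𝒦.filter fun K => ¬ bad K).card * 3 ≤
      ∑ K ∈ 𝒦.filter (fun K => ¬ bad K), ((P K).card + 2 * (Z K).card + 3 * (R K).card) :=
    Finset.card_nsmul_le_sum _ _ _ hgood
  rw [Finset.sum_add_distrib, Finset.sum_add_distrib, ← Finset.mul_sum, ← Finset.mul_sum] at hsum
  have e1 := Finset.card_filter_add_card_filter_not (s := 𝒦) bad
  have e2 := Finset.card_filter_add_card_filter_not (s := U.toLeft) (fun x => dead (c x))
  have e3 := Finset.card_filter_le U.toRight (fun τ => ¬ dead τ.1)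
  have e4 := Finset.card_toLeft_add_card_toRight (u := U)
  omega

theorem even_card_of_involutive {W : Type*} (s : Finset W) (f : W → W)
    (hf : Function.Involutive f) (hs : ∀ w ∈ s, f w ∈ s) (hne : ∀ w ∈ s, f w ≠ w) :
    Even s.card := by
  have h : ∑ _w ∈ s, (1 : ZMod 2) = 0 :=
    Finset.sum_involution (fun w _ => f w) (fun _ _ => by decide) (fun w hw _ => hne w hw)
      hs (fun w _ => hf w)
  rw [Finset.sum_const, nsmul_one] at h
  exact (ZMod.natCast_eq_zero_iff_even).1 h

/-- A partial pairing of `X` within the fibres of `v`, recorded as an involution, whose fixed points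
meet every fibre of `c` in a nonempty set of even size. -/
structure IsEvenPairing {X S T : Type*} [Fintype X] [DecidableEq X] [DecidableEq T] (v : X → S)
    (c : X → T) (p : X → X) : Prop where
  involutive : Function.Involutive p
  map_eq : ∀ x, v (p x) = v x
  even_fixed : ∀ τ, Even (Finset.univ.filter fun x => c x = τ ∧ p x = x).card
  exists_fixed : ∀ τ, ∃ x, c x = τ ∧ p x = x

theorem exists_isEvenPairing {X S T : Type*} [Fintype X] [DecidableEq X] [Fintype T]
    [DecidableEq S] [DecidableEq T] (v : X → S) (c : X → T)
    (hv : ∀ s, Even (Finset.univ.filter fun x => v x = s).card)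
    (hc : ∀ τ, 3 ≤ (Finset.univ.filter fun x => c x = τ).card)
    (hcut : ∀ (Y : Finset X) (u : X), Y.Nonempty → (∀ x ∈ Y, ∀ y, c y = c x → y ∈ Y) → u ∉ Y →
      (∃ y ∈ Y, v y = v u) → (∀ y ∈ Y, ∀ x, v x = v y → x ∈ Y ∨ x = u) → False) :
    ∃ p : X → X, IsEvenPairing v c p := by
  obtain ⟨f, hf, hadj⟩ := exists_adj_involution_of_closed_family_card_le (gadgetGraph v c)
    (fun U 𝒦 h1 h2 h3 h4 => closed_family_card_le v c hv hc hcut U 𝒦 h1 h2 h3 h4)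
  let p : X → X := fun x => (f (.inl x)).elim (fun y => if c y = c x then x else y) (fun _ => x)
  have hp1 : ∀ x y, f (.inl x) = .inl y → p x = if c y = c x then x else y := by
    intro x y h
    simp [p, h]
  have hp2 : ∀ x τ, f (.inl x) = .inr τ → p x = x := by
    intro x y h
    simp [p, h]
  have hinr : ∀ τ, ∃ x, f (.inr τ) = .inl x ∧ c x = τ.1 := by
    intro τ
    have := hadj (.inr τ)
    rcases h : f (.inr τ) with x | σ
    · rw [h] at this
      exact ⟨x, rfl, this⟩
    · rw [h] at this
      exact this.elim
  have hswap : ∀ a b, f a = b → f b = a := by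
    rintro a _ rfl
    exact hf a
  have hinl : ∀ x y, f (.inl x) = .inl y → x ≠ y ∧ (v x = v y ∨ c x = c y) := by
    intro x y h
    have := hadj (.inl x)
    rw [h] at this
    exact this
  have hinl' : ∀ x τ, f (.inl x) = .inr τ → c x = τ.1 := by
    intro x y h
    have := hadj (.inl x)
    rw [h] at this
    exact this
  refine ⟨p, ?_, ?_, ?_, ?_⟩
  · intro x
    rcases h : f (.inl x) with y | τ
    · by_cases hxy : c y = c x
      · have : p x = x := by rw [hp1 x y h, if_pos hxy]
        rw [this, this]
      · have : p x = y := by rw [hp1 x y h, if_neg hxy]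
        rw [this, hp1 y x (hswap _ _ h), if_neg (Ne.symm hxy)]
    · rw [hp2 x τ h, hp2 x τ h]
  · intro x
    rcases h : f (.inl x) with y | τ
    · rw [hp1 x y h]
      split_ifs with hxy
      · rfl
      · exact ((hinl x y h).2.resolve_right (Ne.symm hxy)).symm
    · rw [hp2 x τ h]
  · intro τ
    have key := even_card_of_involutive
      ((Finset.univ.filter fun x => c x = τ ∧ p x = x).disjSum
        (Finset.univ.filter fun σ : T × Bool => σ.1 = τ)) f hf ?_ (fun w _ => (hadj w).ne')
    · have h2 : (Finset.univ.filter fun σ : T × Bool => σ.1 = τ) =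
          ({τ} : Finset T) ×ˢ (Finset.univ : Finset Bool) := by
        ext σ
        simp only [Finset.mem_filter, Finset.mem_product, Finset.mem_singleton, Finset.mem_univ,
          true_and, and_true]
      rw [Finset.card_disjSum, h2, Finset.card_product] at key
      simp only [Finset.card_singleton, one_mul, Finset.card_univ, Fintype.card_bool] at key
      rw [Nat.even_iff] at key ⊢
      omega
    · rintro (x | σ) hw
      · simp only [Finset.inl_mem_disjSum, Finset.mem_filter, Finset.mem_univ, true_and] at hw
        obtain ⟨hx, hpx⟩ := hw
        rcases h : f (.inl x) with y | σ
        · have hyx : c y = c x := by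
            by_contra hne
            have := hp1 x y h
            rw [if_neg hne, hpx] at this
            exact (hinl x y h).1 this
          simp only [Finset.inl_mem_disjSum, Finset.mem_filter, Finset.mem_univ, true_and]
          exact ⟨hyx.trans hx, by rw [hp1 y x (hswap _ _ h), if_pos hyx.symm]⟩
        · simp [← hinl' x σ h, hx]
      · obtain ⟨x, hx, hxσ⟩ := hinr σ
        have hσ : σ.1 = τ := by simpa using hw
        rw [hx]
        simp only [Finset.inl_mem_disjSum, Finset.mem_filter, Finset.mem_univ, true_and]
        exact ⟨hxσ.trans hσ, hp2 x σ (hswap _ _ hx)⟩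
  · intro τ
    obtain ⟨x, hx, hxσ⟩ := hinr (τ, true)
    exact ⟨x, hxσ, hp2 x _ (hswap _ _ hx)⟩

theorem exists_eq_of_forall_dependency {M ι : Type*} [Fintype ι] [DecidableEq ι] [AddCommGroup M]
    [Module (ZMod 2) M] (L₁ L₂ : M →ₗ[ZMod 2] (ι → ZMod 2)) (b₁ b₂ : ι → ZMod 2)
    (h : ∀ y z : ι → ZMod 2, (∀ m, ∑ i, L₁ m i * y i + ∑ i, L₂ m i * z i = 0) →
      ∑ i, b₁ i * y i + ∑ i, b₂ i * z i = 0) : ∃ m, L₁ m = b₁ ∧ L₂ m = b₂ := by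
  by_contra hne
  have hb : (b₁, b₂) ∉ LinearMap.range (L₁.prod L₂) := by
    rintro ⟨m, hm⟩
    exact hne ⟨m, congrArg Prod.fst hm, congrArg Prod.snd hm⟩
  obtain ⟨f, hfb, hf⟩ := Submodule.exists_le_ker_of_notMem hb
  have hrep : ∀ w₁ w₂ : ι → ZMod 2, f (w₁, w₂) =
      ∑ i, w₁ i * f (Pi.single i 1, 0) + ∑ i, w₂ i * f (0, Pi.single i 1) := by
    intro w₁ w₂
    have h1 := LinearMap.pi_apply_eq_sum_univ (f.comp (LinearMap.inl (ZMod 2) _ _)) w₁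
    have h2 := LinearMap.pi_apply_eq_sum_univ (f.comp (LinearMap.inr (ZMod 2) _ _)) w₂
    have h3 : (w₁, w₂) = LinearMap.inl (ZMod 2) _ _ w₁ + LinearMap.inr (ZMod 2) _ _ w₂ := by simp
    rw [h3, map_add]
    refine congrArg₂ (· + ·) (h1.trans ?_) (h2.trans ?_)
    · refine Finset.sum_congr rfl fun i _ => ?_
      simp only [LinearMap.comp_apply, smul_eq_mul, LinearMap.inl_apply]
      congr 3
      ext j
      simp [Pi.single_apply, eq_comm]
    · refine Finset.sum_congr rfl fun i _ => ?_
      simp only [LinearMap.comp_apply, smul_eq_mul, LinearMap.inr_apply]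
      congr 3
      ext j
      simp [Pi.single_apply, eq_comm]
  refine hfb ?_
  rw [hrep]
  refine h _ _ fun m => ?_
  rw [← hrep]
  exact hf ⟨m, rfl⟩

theorem exists_maximal_isEvenPairing {X S T : Type*} [Fintype X] [DecidableEq X] [DecidableEq T]
    {v : X → S} {c : X → T} (h : ∃ p : X → X, IsEvenPairing v c p) :
    ∃ p : X → X, IsEvenPairing v c p ∧ ∀ D : Finset X, (∀ x ∈ D, p x ∈ D ∧ p x ≠ x) →
      (∀ τ, Even (D.filter fun x => c x = τ).card) → D = ∅ := by
  classical
  obtain ⟨p₀, hp₀⟩ := h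
  obtain ⟨p, hp, hmax⟩ := Finset.exists_max_image
    (Finset.univ.filter fun p : X → X => IsEvenPairing v c p)
    (fun p => (Finset.univ.filter fun x => p x = x).card) ⟨p₀, by simpa using hp₀⟩
  replace hp : IsEvenPairing v c p := by simpa using hp
  refine ⟨p, hp, fun D hD hDe => ?_⟩
  let q : X → X := fun x => if x ∈ D then x else p x
  have hpD : ∀ x, x ∉ D → p x ∉ D := by
    intro x hx h
    have := (hD _ h).1
    rw [hp.involutive] at this
    exact hx this
  have hfix : ∀ x, q x = x ↔ p x = x ∨ x ∈ D := by
    intro x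
    by_cases hx : x ∈ D <;> simp [q, hx]
  have hq : IsEvenPairing v c q := by
    refine ⟨fun x => ?_, fun x => ?_, fun τ => ?_, fun τ => ?_⟩
    · by_cases hx : x ∈ D
      · simp [q, hx]
      · simp [q, hx, hpD x hx, hp.involutive x]
    · by_cases hx : x ∈ D
      · simp [q, hx]
      · simp [q, hx, hp.map_eq]
    · have : (Finset.univ.filter fun x => c x = τ ∧ q x = x) =
          (Finset.univ.filter fun x => c x = τ ∧ p x = x) ∪ D.filter fun x => c x = τ := by
        ext x
        simp only [hfix, Finset.mem_union, Finset.mem_filter, Finset.mem_univ, true_and]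
        tauto
      rw [this, Finset.card_union_of_disjoint]
      · exact (hp.even_fixed τ).add (hDe τ)
      · refine Finset.disjoint_left.2 fun x hx hx' => ?_
        exact (hD x (Finset.mem_filter.1 hx').1).2 (Finset.mem_filter.1 hx).2.2
    · obtain ⟨x, hx, hpx⟩ := hp.exists_fixed τ
      exact ⟨x, hx, (hfix x).2 (Or.inl hpx)⟩
  have hle := hmax q (by simpa using hq)
  have : (Finset.univ.filter fun x => q x = x) = (Finset.univ.filter fun x => p x = x) ∪ D := by
    ext x
    simp [hfix]
  rw [this, Finset.card_union_of_disjoint] at hle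
  · exact Finset.card_eq_zero.1 (by omega)
  · refine Finset.disjoint_left.2 fun x hx hx' => ?_
    exact (hD x hx').2 (Finset.mem_filter.1 hx).2

/-- If an even pairing exists, then for some even pairing `p` the edges of the trails can be coloured
so that the two darts of `x` differ in colour when `p x = x`, and otherwise agree and are coloured
oppositely to those of `p x`. -/
theorem exists_coloring_of_isEvenPairing {X S T : Type*} [Fintype X] [DecidableEq X] [Fintype T]
    [DecidableEq T] (v : X → S) (c : X → T) (rev : X × Bool → X × Bool)
    (hrev : Function.Involutive rev) (hrev_ne : ∀ d, rev d ≠ d)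
    (hcrev : ∀ d, c (rev d).1 = c d.1)
    (hlift : ∀ y : X → ZMod 2, (∀ d, y (rev d).1 = y d.1) → ∃ Y : T → ZMod 2, ∀ x, y x = Y (c x))
    (h : ∃ p : X → X, IsEvenPairing v c p) :
    ∃ (p : X → X) (col : X × Bool → ZMod 2), IsEvenPairing v c p ∧ (∀ d, col (rev d) = col d) ∧
      (∀ x, col (x, false) + col (x, true) = if p x = x then 1 else 0) ∧
      ∀ x, col (x, false) + col (p x, false) = if p x = x then 0 else 1 := by
  obtain ⟨p, hp, hmax⟩ := exists_maximal_isEvenPairing h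
  have two : ∀ a : ZMod 2, a + a = 0 := by decide
  let C : X × Bool → (X × Bool → ZMod 2) →ₗ[ZMod 2] ZMod 2 := fun d =>
    (LinearMap.proj d : (X × Bool → ZMod 2) →ₗ[ZMod 2] ZMod 2) + LinearMap.proj (rev d)
  have hC : ∀ d ψ, C d ψ = ψ d + ψ (rev d) := fun d ψ => rfl
  refine (exists_eq_of_forall_dependency
    (LinearMap.pi fun x => C (x, false) + C (x, true))
    (LinearMap.pi fun x => C (x, false) + C (p x, false))
    (fun x => if p x = x then 1 else 0) (fun x => if p x = x then 0 else 1) ?_).elim ?_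
  swap
  · rintro ψ ⟨h1, h2⟩
    refine ⟨p, fun d => C d ψ, hp, fun d => ?_, fun x => congrFun h1 x, fun x => congrFun h2 x⟩
    simp only [hC, hrev d, add_comm]
  intro y z hyz
  simp only [LinearMap.pi_apply, LinearMap.add_apply] at hyz
  let g : X → ZMod 2 := fun x => z x + z (p x)
  let Y : X × Bool → ZMod 2 := fun d => if d.2 then y d.1 else y d.1 + g d.1
  have hY : ∀ ψ, ∑ d, C d ψ * Y d = 0 := by
    intro ψ
    rw [← hyz ψ, Fintype.sum_prod_type, ← Finset.sum_add_distrib]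
    have e : ∑ x, C (p x, false) ψ * z x = ∑ x, C (x, false) ψ * z (p x) := by
      refine Fintype.sum_equiv hp.involutive.toPerm _ _ fun x => ?_
      simp [hp.involutive x]
    have e2 : ∑ x, ((C (x, false) ψ + C (x, true) ψ) * y x +
        (C (x, false) ψ + C (p x, false) ψ) * z x) =
        ∑ x, ((C (x, false) ψ + C (x, true) ψ) * y x + C (x, false) ψ * z x) +
          ∑ x, C (p x, false) ψ * z x := by
      rw [← Finset.sum_add_distrib]
      exact Finset.sum_congr rfl fun x _ => by ring
    rw [e2, e, ← Finset.sum_add_distrib]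
    refine Finset.sum_congr rfl fun x _ => ?_
    simp [Y, g]
    ring
  have hYrev : ∀ d, Y (rev d) = Y d := by
    intro d
    have h1 := hY (Pi.single d 1)
    simp only [hC, add_mul, Finset.sum_add_distrib] at h1
    have e : ∑ x, (Pi.single d 1 : X × Bool → ZMod 2) (rev x) * Y x =
        ∑ x, (Pi.single d 1 : X × Bool → ZMod 2) x * Y (rev x) := by
      refine Fintype.sum_equiv hrev.toPerm _ _ fun x => ?_
      simp [hrev x]
    rw [e] at h1
    simp [Pi.single_apply] at h1
    have : ∀ a b : ZMod 2, a + b = 0 → b = a := by decide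
    exact this _ _ h1
  have hgp : ∀ x, g (p x) = g x := fun x => by simp [g, hp.involutive x, add_comm]
  have hD := hmax (Finset.univ.filter fun x => g x ≠ 0) ?_ ?_
  · have hg : ∀ x, g x = 0 := by
      intro x
      by_contra hx
      have : x ∈ Finset.univ.filter fun x => g x ≠ 0 := by simpa using hx
      rw [hD] at this
      exact Finset.notMem_empty _ this
    have hYy : ∀ d, Y d = y d.1 := by
      intro d
      simp [Y, hg]
    obtain ⟨F, hF⟩ := hlift y fun d => by rw [← hYy, ← hYy, hYrev]
    have s1 : ∑ x, (if p x = x then 1 else 0) * y x = 0 := by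
      rw [← Finset.sum_fiberwise Finset.univ c]
      refine Finset.sum_eq_zero fun τ _ => ?_
      have := (ZMod.natCast_eq_zero_iff_even).2 (hp.even_fixed τ)
      calc _ = ∑ x ∈ Finset.univ.filter (fun x => c x = τ), (if p x = x then 1 else 0) * F τ := by
            refine Finset.sum_congr rfl fun x hx => ?_
            rw [hF, (Finset.mem_filter.1 hx).2]
        _ = 0 := by
            rw [← Finset.sum_mul, Finset.sum_boole, Finset.filter_filter, this, zero_mul]
    have s2 : ∑ x, (if p x = x then 0 else 1) * z x = 0 := by
      refine Finset.sum_involution (fun x _ => p x) (fun x _ => ?_) (fun x _ hx h => ?_)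
        (fun _ _ => Finset.mem_univ _) (fun x _ => hp.involutive x)
      · have := hg x
        simp only [g] at this
        rw [hp.involutive x]
        by_cases hx : p x = x
        · simp [hx]
        · simp [hx, Ne.symm hx, this]
      · simp [h] at hx
    rw [s1, s2, add_zero]
  · intro x hx
    have hx := (Finset.mem_filter.1 hx).2
    refine ⟨by simpa [hgp] using hx, fun h => hx ?_⟩
    simp [g, h, two]
  · intro τ
    rw [← ZMod.natCast_eq_zero_iff_even, Finset.filter_filter]
    have e1 : ∀ x, g x = if g x ≠ 0 then 1 else 0 := by
      intro x
      generalize g x = a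
      revert a
      decide
    have e2 : ∑ x ∈ Finset.univ.filter (fun x => c x = τ), g x = 0 := by
      have : ∑ d ∈ (Finset.univ.filter fun x => c x = τ) ×ˢ (Finset.univ : Finset Bool), Y d =
          0 := by
        refine Finset.sum_involution (fun d _ => rev d) (fun d _ => ?_) (fun d _ _ => hrev_ne d)
          (fun d hd => ?_) (fun d _ => hrev d)
        · rw [hYrev, two]
        · simpa [hcrev] using hd
      rw [Finset.sum_product] at this
      rw [← this]
      refine Finset.sum_congr rfl fun x _ => ?_
      simp only [Fintype.sum_bool, Y]
      simp [← add_assoc, two]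
    rw [Finset.sum_congr rfl fun x _ => e1 x, Finset.sum_boole, Finset.filter_filter] at e2
    simpa only [and_comm] using e2

/-- A finite set of size `2 * t` can be listed in `t` pairs so that each member of a given disjoint
family of two-element subsets is one of the pairs. -/
theorem exists_pair_enumeration {α : Type*} [DecidableEq α] (t : ℕ) (s : Finset α)
    (pairs : Finset (Finset α)) (hs : s.card = 2 * t) (hpairs : ∀ P ∈ pairs, P ⊆ s ∧ P.card = 2)
    (hdis : ∀ P ∈ pairs, ∀ Q ∈ pairs, ∀ a, a ∈ P → a ∈ Q → P = Q) :
    ∃ f : Fin t × Bool → α, Function.Injective f ∧ (∀ d, f d ∈ s) ∧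
      ∀ P ∈ pairs, ∀ i b, f (i, b) ∈ P → f (i, !b) ∈ P := by
  induction t generalizing s pairs with
  | zero => exact ⟨fun d => d.1.elim0, fun d => d.1.elim0, fun d => d.1.elim0,
      fun _ _ i => i.elim0⟩
  | succ t ih =>
    have hab : ∃ a ∈ s, ∃ b ∈ s, a ≠ b ∧ ∀ P ∈ pairs, (a ∈ P ∨ b ∈ P) → P = {a, b} := by
      rcases pairs.eq_empty_or_nonempty with h | ⟨P, hP⟩
      · obtain ⟨a, ha, b, hb, hne⟩ := Finset.one_lt_card.1 (show 1 < s.card by omega)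
        exact ⟨a, ha, b, hb, hne, by simp [h]⟩
      · obtain ⟨hPs, hPc⟩ := hpairs P hP
        obtain ⟨a, b, hne, rfl⟩ := Finset.card_eq_two.1 hPc
        refine ⟨a, hPs (by simp), b, hPs (by simp), hne, fun Q hQ h => ?_⟩
        rcases h with h | h
        · exact hdis _ hQ _ hP a h (by simp)
        · exact hdis _ hQ _ hP b h (by simp)
    obtain ⟨a, ha, b, hb, hne, hP⟩ := hab
    obtain ⟨f, hf, hfs, hfP⟩ := ih (s \ {a, b}) (pairs.filter fun P => a ∉ P ∧ b ∉ P)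
      (by
        rw [Finset.card_sdiff_of_subset (by simp [Finset.insert_subset_iff, ha, hb]), hs,
          Finset.card_pair hne]
        omega)
      (by
        intro P hP
        obtain ⟨hP, haP, hbP⟩ := Finset.mem_filter.1 hP
        refine ⟨fun x hx => Finset.mem_sdiff.2 ⟨(hpairs P hP).1 hx, ?_⟩, (hpairs P hP).2⟩
        rintro h
        rcases Finset.mem_insert.1 h with rfl | h
        · exact haP hx
        · rw [Finset.mem_singleton.1 h] at hx
          exact hbP hx)
      (fun P hP Q hQ => hdis P (Finset.mem_filter.1 hP).1 Q (Finset.mem_filter.1 hQ).1)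
    have hfa : ∀ d, f d ≠ a := fun d h => by
      have := hfs d
      simp [h] at this
    have hfb : ∀ d, f d ≠ b := fun d h => by
      have := hfs d
      simp [h] at this
    let F : Fin (t + 1) × Bool → α := fun d =>
      Fin.cases (motive := fun _ => α) (if d.2 then a else b) (fun i => f (i, d.2)) d.1
    have F0 : ∀ β, F (0, β) = if β then a else b := fun β => rfl
    have FS : ∀ i β, F (Fin.succ i, β) = f (i, β) := fun i β => rfl
    refine ⟨F, ?_, ?_, ?_⟩
    · rintro ⟨i, β⟩ ⟨j, γ⟩ h
      induction i using Fin.cases with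
      | zero =>
        induction j using Fin.cases with
        | zero =>
          cases β <;> cases γ <;> simp [F0, hne, hne.symm] at h ⊢
        | succ j =>
          rw [F0, FS] at h
          split_ifs at h
          · exact absurd h.symm (hfa _)
          · exact absurd h.symm (hfb _)
      | succ i =>
        induction j using Fin.cases with
        | zero =>
          rw [F0, FS] at h
          split_ifs at h
          · exact absurd h (hfa _)
          · exact absurd h (hfb _)
        | succ j =>
          rw [FS, FS] at h
          have := hf h
          simp only [Prod.mk.injEq] at this
          rw [this.1, this.2]
    · rintro ⟨i, β⟩
      induction i using Fin.cases with
      | zero => cases β <;> simp [F0, ha, hb]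
      | succ i =>
        rw [FS]
        exact (Finset.mem_sdiff.1 (hfs _)).1
    · intro P hPm i β h
      induction i using Fin.cases with
      | zero =>
        have : P = {a, b} := by
          refine hP P hPm ?_
          cases β
          · exact Or.inr h
          · exact Or.inl h
        rw [this]
        cases β <;> simp [F0]
      | succ i =>
        rw [FS] at h ⊢
        by_cases hx : a ∈ P ∨ b ∈ P
        · rw [hP P hPm hx] at h
          rcases Finset.mem_insert.1 h with h | h
          · exact absurd h (hfa _)
          · exact absurd (Finset.mem_singleton.1 h) (hfb _)
        · exact hfP P (Finset.mem_filter.2 ⟨hPm, not_or.1 hx⟩) i β h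

/-- `head` indexes the darts of `G`: each dart is given by its tail, an index `i` of a pair of darts
leaving that tail, and a choice within the pair. -/
structure IsDartIndexing {V : Type*} (G : SimpleGraph V) {t : ℕ} (head : (V × Fin t) × Bool → V) :
    Prop where
  adj : ∀ d, G.Adj d.1.1 (head d)
  exists_eq : ∀ u w, G.Adj u w → ∃ d, d.1.1 = u ∧ head d = w
  ext : ∀ d e, d.1.1 = e.1.1 → head d = head e → d = e

theorem exists_isDartIndexing {V : Type*} [Fintype V] (G : SimpleGraph V) (t : ℕ)
    (hG : ∀ v, (G.neighborSet v).ncard = 2 * t) (pairs : V → Finset (Finset V))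
    (hpairs : ∀ v, ∀ P ∈ pairs v, (∀ w ∈ P, G.Adj v w) ∧ P.card = 2)
    (hdis : ∀ v, ∀ P ∈ pairs v, ∀ Q ∈ pairs v, ∀ a, a ∈ P → a ∈ Q → P = Q) :
    ∃ head : (V × Fin t) × Bool → V, IsDartIndexing G head ∧
      ∀ x b, ∀ P ∈ pairs x.1, head (x, b) ∈ P → head (x, !b) ∈ P := by
  classical
  have hcard : ∀ v, (G.neighborSet v).toFinset.card = 2 * t := fun v => by
    rw [← Set.ncard_eq_toFinset_card', hG]
  choose f hf hfs hfP using fun v => exists_pair_enumeration t (G.neighborSet v).toFinset (pairs v)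
    (hcard v) (fun P hP => ⟨fun w hw => by simpa using (hpairs v P hP).1 w hw, (hpairs v P hP).2⟩)
    (hdis v)
  refine ⟨fun d => f d.1.1 (d.1.2, d.2), ⟨fun d => ?_, fun u w h => ?_, ?_⟩,
    fun x b P hP h => hfP x.1 P hP x.2 b h⟩
  · simpa using hfs d.1.1 (d.1.2, d.2)
  · have himage : Finset.univ.image (f u) = (G.neighborSet u).toFinset := by
      refine Finset.eq_of_subset_of_card_le (fun w hw => ?_) ?_
      · obtain ⟨d, -, rfl⟩ := Finset.mem_image.1 hw
        exact hfs u d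
      · rw [hcard, Finset.card_image_of_injective _ (hf u)]
        simp [mul_comm]
    have hw : w ∈ (G.neighborSet u).toFinset := by simpa using h
    rw [← himage] at hw
    obtain ⟨d, -, hd⟩ := Finset.mem_image.1 hw
    exact ⟨((u, d.1), d.2), rfl, hd⟩
  · rintro ⟨⟨u, i⟩, b⟩ ⟨⟨w, j⟩, b'⟩ h h'
    obtain rfl : u = w := h
    have := hf u h'
    simp only [Prod.mk.injEq] at this
    rw [this.1, this.2]

theorem IsDartIndexing.exists_reverse {V : Type*} {G : SimpleGraph V} {t : ℕ}
    {head : (V × Fin t) × Bool → V} (h : IsDartIndexing G head) :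
    ∃ rev : (V × Fin t) × Bool → (V × Fin t) × Bool, Function.Involutive rev ∧
      ∀ d, (rev d).1.1 = head d ∧ head (rev d) = d.1.1 := by
  choose rev h1 h2 using fun d => h.exists_eq _ _ (h.adj d).symm
  exact ⟨rev, fun d => h.ext _ _ ((h1 _).trans (h2 d)) ((h2 _).trans (h1 d)),
    fun d => ⟨h1 d, h2 d⟩⟩

theorem card_filter_tail_eq {V : Type*} [Fintype V] [DecidableEq V] {t : ℕ} (v : V)
    (P : (V × Fin t) × Bool → Prop) [DecidablePred P] :
    (Finset.univ.filter fun d : (V × Fin t) × Bool => d.1.1 = v ∧ P d).card =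
      ∑ i : Fin t, ∑ b : Bool, if P ((v, i), b) then 1 else 0 := by
  rw [Finset.card_filter, Fintype.sum_prod_type, Fintype.sum_prod_type, Finset.sum_comm]
  refine Finset.sum_congr rfl fun i _ => ?_
  rw [Finset.sum_eq_single v]
  · simp
  · intro w _ hw
    simp [hw]
  · simp

theorem IsDartIndexing.ncard_setOf_eq {V : Type*} [Fintype V] [DecidableEq V] {G : SimpleGraph V}
    {t : ℕ} {head : (V × Fin t) × Bool → V} (h : IsDartIndexing G head) (v : V)
    (P : (V × Fin t) × Bool → Prop) [DecidablePred P] :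
    {w | ∃ d, d.1.1 = v ∧ head d = w ∧ P d}.ncard =
      ∑ i : Fin t, ∑ b : Bool, if P ((v, i), b) then 1 else 0 := by
  rw [← card_filter_tail_eq, ← Set.ncard_coe_finset, ← Set.InjOn.ncard_image (f := head)]
  · congr 1
    ext w
    simp only [Set.mem_ofPred_eq, Set.mem_image, Finset.coe_filter, Finset.mem_univ, true_and]
    exact exists_congr fun d => by tauto
  · intro d hd e he hde
    simp only [Finset.coe_filter, Finset.mem_univ, true_and, Set.mem_ofPred_eq] at hd he
    exact h.ext _ _ (hd.1.trans he.1.symm) hde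

/-- Two fixed-point-free involutions can simultaneously be made to switch the sides of a
bipartition. -/
theorem exists_bool_switched_by_involutions {D : Type*} (a b : D → D)
    (ha : Function.Involutive a) (hb : Function.Involutive b) (ha' : ∀ d, a d ≠ d)
    (hb' : ∀ d, b d ≠ d) :
    ∃ f : D → Bool, (∀ d, f (a d) = !f d) ∧ ∀ d, f (b d) = !f d := by
  classical
  let α : Equiv.Perm D := ha.toPerm
  let β : Equiv.Perm D := hb.toPerm
  have hαα : α * α = 1 := Equiv.ext ha
  have hββ : β * β = 1 := Equiv.ext hb
  let h : Equiv.Perm D := β * α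
  have hinv : α * h * α⁻¹ = h⁻¹ := by
    have e1 : α⁻¹ = α := inv_eq_of_mul_eq_one_left hαα
    have e2 : β⁻¹ = β := inv_eq_of_mul_eq_one_left hββ
    simp only [h, mul_inv_rev, e1, e2]
    rw [mul_assoc, mul_assoc, hαα, mul_one]
  have hcomm : ∀ n : ℤ, α * h ^ n = h ^ (-n) * α := by
    intro n
    have := conj_zpow (i := n) (a := α) (b := h)
    rw [hinv, inv_zpow'] at this
    rw [this]
    group
  have hsep : ∀ d, ¬ h.SameCycle d (a d) := by
    rintro d ⟨n, hn⟩
    rcases Int.even_or_odd' n with ⟨m, rfl | rfl⟩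
    · apply ha' ((h ^ m) d)
      have e : (α * h ^ m) d = (h ^ (-m) * h ^ (2 * m)) d := by
        rw [hcomm, Equiv.Perm.mul_apply, Equiv.Perm.mul_apply, hn]
        rfl
      rw [← zpow_add, show -m + 2 * m = m by ring] at e
      exact e
    · apply hb' (a ((h ^ m) d))
      have e : (α * h ^ m) d = (h ^ (-m) * h ^ (2 * m + 1)) d := by
        rw [hcomm, Equiv.Perm.mul_apply, Equiv.Perm.mul_apply, hn]
        rfl
      rw [← zpow_add, show -m + (2 * m + 1) = 1 + m by ring, zpow_add, zpow_one] at e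
      exact e.symm
  let Q := Quotient (Equiv.Perm.SameCycle.setoid h)
  let : LinearOrder Q := IsWellOrder.linearOrder WellOrderingRel
  let q : D → Q := fun d => Quotient.mk (Equiv.Perm.SameCycle.setoid h) d
  have hq : ∀ d, q d ≠ q (a d) := fun d hd => hsep d (Quotient.exact hd)
  have hqh : ∀ d, q (h d) = q d := fun d => Quotient.sound (by
    show h.SameCycle (h d) d
    exact Equiv.Perm.sameCycle_apply_left.2 (Equiv.Perm.SameCycle.refl h d))
  have hba : ∀ d, q (b d) = q (a d) := by
    intro d
    have := hqh (a d)
    rw [← this]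
    congr 1
    exact congrArg b (ha d).symm
  have hab : ∀ d, q (a (b d)) = q d := by
    intro d
    rw [← hba (b d), hb d]
  refine ⟨fun d => decide (q d < q (a d)), fun d => ?_, fun d => ?_⟩
  · show decide (q (a d) < q (a (a d))) = !decide (q d < q (a d))
    rw [ha d]
    rcases lt_or_gt_of_ne (hq d) with hlt | hlt
    · simp [hlt, hlt.le]
    · simp [hlt, hlt.le]
  · show decide (q (b d) < q (a (b d))) = !decide (q d < q (a d))
    rw [hab d, hba d]
    rcases lt_or_gt_of_ne (hq d) with hlt | hlt
    · simp [hlt, hlt.le]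
    · simp [hlt, hlt.le]

theorem ncard_neighborSet_sdiff {V : Type*} [Finite V] {G H : SimpleGraph V} (hle : H ≤ G)
    (v : V) : ((G \ H).neighborSet v).ncard =
      (G.neighborSet v).ncard - (H.neighborSet v).ncard := by
  rw [← Set.ncard_sdiff (show H.neighborSet v ⊆ G.neighborSet v from fun _ h => hle h)]
  rfl

theorem ncard_neighborSet_sup {V : Type*} [Finite V] {G H : SimpleGraph V} (hdis : Disjoint G H)
    (v : V) : ((G ⊔ H).neighborSet v).ncard =
      (G.neighborSet v).ncard + (H.neighborSet v).ncard := by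
  rw [← Set.ncard_union_eq]
  · rfl
  · rw [Set.disjoint_left]
    exact fun w h h' => SimpleGraph.disjoint_left.1 hdis v w h h'

/-- Petersen's 2-factor theorem. -/
theorem exists_two_factor_of_even_degree {V : Type*} [Fintype V] (H : SimpleGraph V) (k : ℕ)
    (hk : 1 ≤ k) (hH : ∀ v, (H.neighborSet v).ncard = 2 * k) :
    ∃ H' ≤ H, ∀ v, (H'.neighborSet v).ncard = 2 := by
  classical
  obtain ⟨head, hI, -⟩ := exists_isDartIndexing H k hH (fun _ => ∅) (by simp) (by simp)
  obtain ⟨rev, hrev, hr⟩ := hI.exists_reverse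
  have hrev_ne : ∀ d, rev d ≠ d := fun d h => (hI.adj d).ne (by rw [← (hr d).1, h])
  obtain ⟨f, hf, hf'⟩ := exists_bool_switched_by_involutions rev (fun d => (d.1, !d.2)) hrev
    (fun d => by simp) hrev_ne (fun d h => by simpa using congrArg Prod.snd h)
  let r : V → V → Prop := fun u w => ∃ d, d.1.1 = u ∧ head d = w ∧ f d = true
  have hadj : ∀ u w, r u w → H.Adj u w := by
    rintro _ _ ⟨d, rfl, rfl, -⟩
    exact hI.adj d
  have hasymm : ∀ u w, r u w → ¬ r w u := by
    rintro _ _ ⟨d, rfl, rfl, hd⟩ ⟨e, he1, he2, he⟩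
    have : e = rev d := hI.ext _ _ (he1.trans (hr d).1.symm) (he2.trans (hr d).2.symm)
    rw [this, hf, hd] at he
    simp at he
  have hsum : ∀ v β, ∑ i : Fin k, ∑ b : Bool, (if f ((v, i), b) = β then 1 else 0) = k := by
    intro v β
    have : ∀ i : Fin k, ∑ b : Bool, (if f ((v, i), b) = β then 1 else 0) = 1 := by
      intro i
      have h := hf' ((v, i), true)
      simp only [Bool.not_true] at h
      rw [Fintype.sum_bool, h]
      cases f ((v, i), true) <;> cases β <;> simp
    rw [Finset.sum_congr rfl fun i _ => this i]
    simp
  have hout : ∀ u, (Finset.univ.filter fun w => r u w).card = k := by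
    intro u
    refine Eq.trans ?_ ((hI.ncard_setOf_eq u fun d => f d = true).trans (hsum u true))
    rw [← Set.ncard_coe_finset]
    congr 1
    ext w
    simp [r]
  have hin : ∀ w, (Finset.univ.filter fun u => r u w).card = k := by
    intro w
    refine Eq.trans ?_ ((hI.ncard_setOf_eq w fun d => f d = false).trans (hsum w false))
    rw [← Set.ncard_coe_finset]
    congr 1
    ext u
    simp only [Finset.coe_filter, Finset.mem_univ, true_and, Set.mem_ofPred_eq, r]
    constructor
    · rintro ⟨d, h1, h2, h3⟩
      exact ⟨rev d, (hr d).1.trans h2, (hr d).2.trans h1, by rw [hf, h3]; rfl⟩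
    · rintro ⟨d, h1, h2, h3⟩
      exact ⟨rev d, (hr d).1.trans h2, (hr d).2.trans h1, by rw [hf, h3]; rfl⟩
  obtain ⟨π, hπ, hπr⟩ := (Finset.all_card_le_biUnion_card_iff_exists_injective
    fun u => Finset.univ.filter fun w => r u w).1 (fun s => by
      refine Nat.le_of_mul_le_mul_right (Finset.card_mul_le_card_mul r (fun a ha => ?_)
        (fun b _ => ?_)) hk
      · refine (hout a).ge.trans (Finset.card_le_card fun w hw => ?_)
        exact Finset.mem_filter.2 ⟨Finset.mem_biUnion.2 ⟨a, ha, hw⟩, (Finset.mem_filter.1 hw).2⟩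
      · refine (Finset.card_le_card ?_).trans (hin b).le
        exact Finset.filter_subset_filter _ (Finset.subset_univ s))
  replace hπr : ∀ u, r u (π u) := fun u => (Finset.mem_filter.1 (hπr u)).2
  let e : V ≃ V := Equiv.ofBijective π (Finite.injective_iff_bijective.1 hπ)
  have he : ∀ u, r u (e u) := hπr
  have he' : ∀ u, r (e.symm u) u := fun u => by simpa using he (e.symm u)
  refine ⟨⟨fun u w => e u = w ∨ e w = u, ⟨fun u w h => h.symm⟩, ⟨fun u h => ?_⟩⟩, ?_, fun v => ?_⟩
  · have : e u = u := by simpa using h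
    have h := he u
    rw [this] at h
    exact (hadj _ _ h).ne rfl
  · rintro u w (rfl | rfl)
    · exact hadj _ _ (he u)
    · exact (hadj _ _ (he w)).symm
  · have hne : e v ≠ e.symm v := fun h => hasymm _ _ (he v) (by rw [h]; exact he' v)
    rw [← Set.ncard_pair hne]
    congr 1
    ext w
    simp only [SimpleGraph.mem_neighborSet, Set.mem_insert_iff, Set.mem_singleton_iff,
      Equiv.eq_symm_apply, eq_comm]

theorem exists_factor_of_even_degree {V : Type*} [Fintype V] (H : SimpleGraph V) (k m : ℕ)
    (hm : m ≤ k) (hH : ∀ v, (H.neighborSet v).ncard = 2 * k) :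
    ∃ H' ≤ H, ∀ v, (H'.neighborSet v).ncard = 2 * m := by
  induction m generalizing H k with
  | zero => exact ⟨⊥, bot_le, fun v => by simp⟩
  | succ m ih =>
    obtain ⟨H₁, hle₁, h₁⟩ := exists_two_factor_of_even_degree H k (by omega) hH
    obtain ⟨H₂, hle₂, h₂⟩ := ih (H \ H₁) (k - 1) (by omega) fun v => by
      rw [ncard_neighborSet_sdiff hle₁, hH, h₁]
      omega
    refine ⟨H₁ ⊔ H₂, sup_le hle₁ (hle₂.trans sdiff_le), fun v => ?_⟩
    rw [ncard_neighborSet_sup (disjoint_sdiff_self_right.mono_right hle₂), h₁, h₂]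
    omega

theorem IsDartIndexing.three_le_card_filter {V T : Type*} [Fintype V] [DecidableEq T]
    {G : SimpleGraph V} {t : ℕ} {head : (V × Fin t) × Bool → V} (h : IsDartIndexing G head)
    (rev : (V × Fin t) × Bool → (V × Fin t) × Bool) (hr : ∀ d, (rev d).1.1 = head d)
    (c : V × Fin t → T) (hc : ∀ d, c (rev d).1 = c d.1) (x : V × Fin t) :
    3 ≤ (Finset.univ.filter fun y => c y = c x).card := by
  refine Finset.two_lt_card.2 ⟨x, by simp, (rev (x, false)).1, by simp [hc], (rev (x, true)).1,
    by simp [hc], fun e => ?_, fun e => ?_, fun e => ?_⟩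
  · exact (h.adj (x, false)).ne (by rw [← hr, ← e])
  · exact (h.adj (x, true)).ne (by rw [← hr, ← e])
  · have := h.ext (x, false) (x, true) rfl (by rw [← hr, ← hr, e])
    simp at this

/-- In a graph without cut vertices, a nonempty set of pairs of darts that is closed under
reversal cannot contain all pairs but `u` at each vertex it meets, with `u` at one of these. -/
theorem IsDartIndexing.mem_of_forall_mem_or_eq {V : Type*} {G : SimpleGraph V} {t : ℕ}
    {head : (V × Fin t) × Bool → V} (h : IsDartIndexing G head)
    (rev : (V × Fin t) × Bool → (V × Fin t) × Bool) (hrev : Function.Involutive rev)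
    (hr : ∀ d, (rev d).1.1 = head d) (hG : ∀ v, (G.induce {u | u ≠ v}).Connected)
    (Y : Finset (V × Fin t)) (u y₀ : V × Fin t) (hY : ∀ d, d.1 ∈ Y → (rev d).1 ∈ Y)
    (hy₀ : y₀ ∈ Y) (hy₀u : y₀.1 = u.1) (hYu : ∀ y ∈ Y, ∀ x, x.1 = y.1 → x ∈ Y ∨ x = u) :
    u ∈ Y := by
  have hall : ∀ x y, y ∈ Y → x.1 = y.1 → x.1 ≠ u.1 → x ∈ Y := fun x y hy hxy hne =>
    (hYu y hy x hxy).resolve_right fun e => hne (congrArg Prod.fst e)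
  have hwalk : ∀ (a b : {w | w ≠ u.1}), (G.induce {w | w ≠ u.1}).Walk a b →
      (∃ y ∈ Y, y.1 = a.1) → ∃ y ∈ Y, y.1 = b.1 := by
    intro a b w
    induction w with
    | nil => exact id
    | @cons a b _ hab _ ih =>
      rintro ⟨y, hy, hya⟩
      obtain ⟨d, hd, hdb⟩ := h.exists_eq a.1 b.1 hab
      have hdY : d.1 ∈ Y := hall d.1 y hy (hd.trans hya.symm) (by rw [hd]; exact a.2)
      exact ih ⟨_, hY d hdY, (hr d).trans hdb⟩
  have hne : head (u, false) ≠ u.1 := (h.adj (u, false)).ne'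
  have hne₀ : head (y₀, false) ≠ u.1 := hy₀u ▸ (h.adj (y₀, false)).ne'
  obtain ⟨w⟩ := (hG u.1).preconnected ⟨head (y₀, false), hne₀⟩ ⟨head (u, false), hne⟩
  obtain ⟨y, hy, hyu⟩ := hwalk _ _ w ⟨_, hY (y₀, false) hy₀, hr _⟩
  have := hY (rev (u, false)) (hall _ y hy ((hr _).trans hyu.symm) (by rw [hr]; exact hne))
  rwa [hrev] at this

theorem sum_color_eq {V : Type*} [DecidableEq V] {t : ℕ} (p : V × Fin t → V × Fin t)
    (hp : Function.Involutive p) (hpv : ∀ x, (p x).1 = x.1)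
    (col : (V × Fin t) × Bool → ZMod 2)
    (h₁ : ∀ x, col (x, false) + col (x, true) = if p x = x then 1 else 0)
    (h₂ : ∀ x, col (x, false) + col (p x, false) = if p x = x then 0 else 1) (v : V) :
    ∑ i : Fin t, ∑ b : Bool, (if col ((v, i), b) = 1 then 1 else 0) = t := by
  let r : V × Fin t → ℕ := fun x => ∑ b : Bool, if col (x, b) = 1 then 1 else 0
  have hr : ∀ x, r x + r (p x) = 2 := by
    intro x
    simp only [r, Fintype.sum_bool]
    have e₁ := h₁ x
    by_cases hx : p x = x
    · rw [if_pos hx] at e₁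
      rw [hx]
      generalize col (x, false) = α at *
      generalize col (x, true) = β at *
      revert α β
      decide
    · have e₂ := h₂ x
      have e₃ := h₁ (p x)
      rw [hp x, if_neg (Ne.symm hx)] at e₃
      rw [if_neg hx] at e₁ e₂
      generalize col (x, false) = α at *
      generalize col (x, true) = β at *
      generalize col (p x, false) = γ at *
      generalize col (p x, true) = δ at *
      revert α β γ δ
      decide
  have hpair : ∀ i, (v, (p (v, i)).2) = p (v, i) := fun i => Prod.ext (hpv (v, i)).symm rfl
  have hq : Function.Involutive fun i => (p (v, i)).2 := fun i => by
    simp only [hpair, hp (v, i)]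
  have hsum : ∑ i, r (v, i) = ∑ i, r (p (v, i)) := by
    rw [← Equiv.sum_comp hq.toPerm]
    exact Finset.sum_congr rfl fun i _ => congrArg r (hpair i)
  have htwo : ∑ i, (r (v, i) + r (p (v, i))) = 2 * t := by
    rw [Finset.sum_congr rfl fun i _ => hr (v, i)]
    simp [mul_comm]
  rw [Finset.sum_add_distrib, ← hsum] at htwo
  show ∑ i, r (v, i) = t
  omega

/-- The set of pairs of darts lying in a 2-regular subgraph is a union of trails, provided that the
pairs follow the subgraph. -/
theorem IsDartIndexing.exists_pair_forall_adj {V T : Type*} {G : SimpleGraph V} {t : ℕ}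
    {head : (V × Fin t) × Bool → V} (h : IsDartIndexing G head)
    (rev : (V × Fin t) × Bool → (V × Fin t) × Bool) (hrev : Function.Involutive rev)
    (hr : ∀ d, (rev d).1.1 = head d ∧ head (rev d) = d.1.1) (c : V × Fin t → T)
    (hc : ∀ Q : V × Fin t → Prop, (∀ d, Q (rev d).1 ↔ Q d.1) → ∀ x y, c x = c y → Q x → Q y)
    (O : G.Subgraph) (hO : ∀ x b, O.Adj x.1 (head (x, b)) → O.Adj x.1 (head (x, !b)))
    (u w : V) (huw : O.Adj u w) :
    ∃ x, ∀ y, c y = c x → ∀ b, O.Adj y.1 (head (y, b)) := by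
  have hall : ∀ d : (V × Fin t) × Bool, O.Adj d.1.1 (head d) →
      ∀ b, O.Adj d.1.1 (head (d.1, b)) := by
    intro d hd b
    rcases eq_or_ne b d.2 with rfl | hb
    · exact hd
    · rw [Bool.eq_not.2 hb]
      exact hO d.1 d.2 hd
  have hstep : ∀ d : (V × Fin t) × Bool, (∀ b, O.Adj d.1.1 (head (d.1, b))) →
      ∀ b, O.Adj (rev d).1.1 (head ((rev d).1, b)) := fun d hd => hall _ (by
    rw [(hr d).1, (hr d).2]
    exact (hd d.2).symm)
  obtain ⟨d, rfl, rfl⟩ := h.exists_eq u w huw.adj_sub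
  refine ⟨d.1, fun y hy => hc (fun y => ∀ b, O.Adj y.1 (head (y, b))) (fun d => ⟨fun hd => ?_,
    hstep d⟩) _ _ hy.symm (hall d huw)⟩
  have := hstep _ hd
  rwa [hrev] at this

/-- Given edge-disjoint cycles in a `2 * t`-regular graph without cut vertices, `t` even, some
`t`-factor meets all of them. -/
theorem exists_half_factor {V : Type*} [Fintype V] (t : ℕ) (hte : Even t) (G : SimpleGraph V)
    (hconn : ∀ v : V, (G.induce {u | u ≠ v}).Connected)
    (hreg : ∀ v, (G.neighborSet v).ncard = 2 * t) (𝒪 : Set G.Subgraph)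
    (hcyc : ∀ O ∈ 𝒪, IsCycleSG O) (hdisj : PairwiseEdgeDisjoint 𝒪) :
    ∃ R ≤ G, (∀ v, (R.neighborSet v).ncard = t) ∧ ∀ O ∈ 𝒪, ∃ u w, R.Adj u w ∧ O.Adj u w := by
  classical
  obtain ⟨head, hI, hhead⟩ := exists_isDartIndexing G t hreg
    (fun v => Finset.univ.filter fun P : Finset V =>
      ∃ O ∈ 𝒪, v ∈ O.verts ∧ (P : Set V) = O.neighborSet v)
    (by
      intro v P hP
      obtain ⟨O, hO, hv, hPO⟩ := (Finset.mem_filter.1 hP).2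
      refine ⟨fun w hw => ?_, ?_⟩
      · have : w ∈ O.neighborSet v := hPO ▸ hw
        exact O.adj_sub this
      · rw [← Set.ncard_coe_finset, hPO]
        exact (hcyc O hO).2 v hv)
    (by
      intro v P hP Q hQ a haP haQ
      obtain ⟨O, hO, -, hPO⟩ := (Finset.mem_filter.1 hP).2
      obtain ⟨O', hO', -, hQO⟩ := (Finset.mem_filter.1 hQ).2
      have ha : a ∈ O.neighborSet v := hPO ▸ haP
      have ha' : a ∈ O'.neighborSet v := hQO ▸ haQ
      have : O = O' := by
        by_contra hne
        exact Set.disjoint_left.1 (hdisj hO hO' hne) (Subgraph.mem_edgeSet.2 ha)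
          (Subgraph.mem_edgeSet.2 ha')
      rw [← Finset.coe_inj, hPO, hQO, this])
  obtain ⟨rev, hrev, hr⟩ := hI.exists_reverse
  have hrev_ne : ∀ d, rev d ≠ d := fun d h => (hI.adj d).ne (by rw [← (hr d).1, h])
  let trail : V × Fin t → V × Fin t → Prop := fun x y => ∃ d, x = d.1 ∧ y = (rev d).1
  let c : V × Fin t → Quot trail := Quot.mk trail
  have hcrev : ∀ d, c (rev d).1 = c d.1 := fun d => (Quot.sound ⟨d, rfl, rfl⟩).symm
  let : Fintype (Quot trail) := Fintype.ofFinite _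
  obtain ⟨p, col, hp, hcol, h₁, h₂⟩ := exists_coloring_of_isEvenPairing Prod.fst c rev hrev hrev_ne
    hcrev
    (fun y hy => ⟨Quot.lift y (by rintro _ _ ⟨d, rfl, rfl⟩; exact (hy d).symm), fun x => rfl⟩)
    (exists_isEvenPairing Prod.fst c
      (fun v => by
        have : (Finset.univ.filter fun x : V × Fin t => x.1 = v) = {v} ×ˢ Finset.univ := by
          ext ⟨w, i⟩
          simp [eq_comm]
        rw [this]
        simpa using hte)
      (by
        rintro ⟨x⟩
        exact hI.three_le_card_filter rev (fun d => (hr d).1) c hcrev x)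
      (fun Y u _ hYc hu ⟨y, hy, hyu⟩ hYu => hu (hI.mem_of_forall_mem_or_eq rev hrev
        (fun d => (hr d).1) hconn Y u y (fun d hd => hYc _ hd _ (hcrev d)) hy hyu hYu)))
  refine ⟨⟨fun u w => ∃ d, d.1.1 = u ∧ head d = w ∧ col d = 1, ⟨?_⟩, ⟨?_⟩⟩, ?_, fun v => ?_,
    fun O hO => ?_⟩
  · rintro u w ⟨d, rfl, rfl, hd⟩
    exact ⟨rev d, (hr d).1, (hr d).2, by rw [hcol, hd]⟩
  · rintro u ⟨d, h, h', -⟩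
    exact (hI.adj d).ne (h.trans h'.symm)
  · rintro _ _ ⟨d, rfl, rfl, -⟩
    exact hI.adj d
  · exact (hI.ncard_setOf_eq v fun d => col d = 1).trans
      (sum_color_eq p hp.involutive hp.map_eq col h₁ h₂ v)
  · obtain ⟨v, hv⟩ := (hcyc O hO).1.nonempty
    obtain ⟨w, hw⟩ := Set.nonempty_of_ncard_ne_zero (s := O.neighborSet v) (by
      have : (O.neighborSet v).ncard = 2 := (hcyc O hO).2 v hv
      omega)
    obtain ⟨x, hx⟩ := hI.exists_pair_forall_adj rev hrev hr c
      (fun Q hQ x y hxy hx => by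
        have : Quot.lift Q (by rintro _ _ ⟨d, rfl, rfl⟩; exact propext (hQ d).symm) (c y) := by
          rw [← hxy]
          exact hx
        exact this) O
      (fun x b h => by
        have := hhead x b (O.neighborSet x.1).toFinset (by
          simp only [Finset.mem_filter, Finset.mem_univ, true_and, Set.coe_toFinset]
          exact ⟨O, hO, h.fst_mem, rfl⟩) (by simpa using h)
        simpa using this) v w hw
    obtain ⟨y, hy, hpy⟩ := hp.exists_fixed (c x)
    have hy₁ := h₁ y
    rw [if_pos hpy] at hy₁
    have : ∀ a b : ZMod 2, a + b = 1 → a = 1 ∨ b = 1 := by decide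
    rcases this _ _ hy₁ with h | h
    · exact ⟨y.1, _, ⟨_, rfl, rfl, h⟩, hx y hy false⟩
    · exact ⟨y.1, _, ⟨_, rfl, rfl, h⟩, hx y hy true⟩

/-- In a 2-connected 2t-regular graph (`t` even, `t ≥ 2`), for any set of pairwise
edge-disjoint odd cycles and any `l` with `t ≤ l ≤ 2t` and `l ≡ t (mod 2)`, there is an
`l`-factor meeting every cycle of the set. -/
theorem stmt_13 {V : Type*} [Fintype V] (t : ℕ) (ht : 2 ≤ t) (hte : Even t)
    (G : SimpleGraph V)
    (hconn : TwoConnected G) (hreg : IsRegular G (2 * t))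
    (𝒪 : Set G.Subgraph) (hodd : ∀ O ∈ 𝒪, IsOddCycleSG O)
    (hdisj : PairwiseEdgeDisjoint 𝒪) :
    ∀ l : ℕ, t ≤ l → l ≤ 2 * t → l % 2 = t % 2 →
      ∃ F : G.Subgraph, IsTFactor F l ∧
        ∀ O ∈ 𝒪, (F.edgeSet ∩ O.edgeSet).Nonempty := by
  intro l htl hl hmod
  obtain ⟨R, hR, hRt, hRO⟩ := exists_half_factor t hte G hconn.2.2 hreg 𝒪
    (fun O hO => (hodd O hO).1) hdisj
  obtain ⟨k, hk⟩ := hte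
  obtain ⟨Q, hQ, hQl⟩ := exists_factor_of_even_degree (G \ R) k ((l - t) / 2) (by omega)
    fun v => by
    rw [ncard_neighborSet_sdiff hR, hreg, hRt]
    omega
  refine ⟨toSubgraph (R ⊔ Q) (sup_le hR (hQ.trans sdiff_le)), ⟨toSubgraph.isSpanning _ _,
    fun v => ?_⟩, fun O hO => ?_⟩
  · have := ncard_neighborSet_sup (disjoint_sdiff_self_right.mono_right hQ) v
    rw [hRt, hQl] at this
    refine Eq.trans this ?_
    omega
  · obtain ⟨u, w, huw, huw'⟩ := hRO O hO
    exact ⟨s(u, w), Subgraph.mem_edgeSet.2 (Or.inl huw), Subgraph.mem_edgeSet.2 huw'⟩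

end PaperFormalization
end
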